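/- arXiv:1612.01893 — 2 statements merged into one kernel-verified Lean document; each statement's English description precedes it below -/
import Mathlib

section
/- There exist three-dimensional convex bodies L ⊆ K such that, with Y_1,...,Y_4 iid uniform in L and X_1,...,X_4 iid uniform in K, E[vol(conv{Y_1,...,Y_4})] > E[vol(conv{X_1,...,X_4})]. That is, the expected volume of the convex hull of four iid uniform points in a convex body is not monotone under set inclusion in dimension 3. -/
open MeasureTheory

/-- Three-dimensional space. -/
abbrev Vec : Type := Fin 3 → ℝ

theorem setIntegral_image_affine (M : Matrix (Fin 3) (Fin 3) ℝ) (v : Vec) (hM : M.det ≠ 0)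
    {f : Vec → Vec} (hf : ∀ x, f x = M.mulVec x + v) {s : Set Vec} (hs : MeasurableSet s)
    (φ : Vec → ℝ) : ∫ x in f '' s, φ x = |M.det| * ∫ x in s, φ (f x) := by
  have hinj : Function.Injective f := by
    intro x y hxy
    rw [hf, hf, add_left_inj] at hxy
    exact Matrix.mulVec_injective_of_isUnit ((Matrix.isUnit_iff_isUnit_det M).2 hM.isUnit) hxy
  have hd : ∀ x ∈ s, HasFDerivWithinAt f (Matrix.toLin' M).toContinuousLinearMap s x := by
    intro x _
    have hfun : f = fun y => (Matrix.toLin' M).toContinuousLinearMap y + v := by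
      ext1 y; simp [hf]
    rw [hfun]
    exact ((Matrix.toLin' M).toContinuousLinearMap.hasFDerivWithinAt).add_const v
  rw [integral_image_eq_integral_abs_det_fderiv_smul volume hs hd hinj.injOn]
  have : ((Matrix.toLin' M).toContinuousLinearMap).det = M.det := by
    simp [ContinuousLinearMap.det, LinearMap.det_toLin']
  simp [this, integral_const_mul]

theorem volume_plane_eq_zero (p q r t : ℝ) (h : p ≠ 0 ∨ q ≠ 0 ∨ r ≠ 0) :
    volume {x : Vec | p * x 0 + q * x 1 + r * x 2 = t} = 0 := by
  let l : Vec →ₗ[ℝ] ℝ :=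
    p • LinearMap.proj 0 + q • LinearMap.proj 1 + r • LinearMap.proj 2
  let s : AffineSubspace ℝ Vec :=
    (AffineSubspace.mk' t ⊥ : AffineSubspace ℝ ℝ).comap l.toAffineMap
  have hs : {x : Vec | p * x 0 + q * x 1 + r * x 2 = t} = s := by
    ext x
    simp [s, l, AffineSubspace.mem_mk', sub_eq_zero]
  rw [hs]
  refine Measure.addHaar_affineSubspace _ _ fun htop => ?_
  have hall : ∀ x : Vec, p * x 0 + q * x 1 + r * x 2 = t := fun x => by
    have : x ∈ (s : Set Vec) := by rw [htop]; trivial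
    rwa [← hs] at this
  have h0 := hall 0
  have h1 := hall ![1, 0, 0]
  have h2 := hall ![0, 1, 0]
  have h3 := hall ![0, 0, 1]
  simp at h0 h1 h2 h3
  subst h0
  simp_all

/-- The corner simplex with vertices at the origin and the standard basis vectors. -/
def corner : Set Vec := {x | 0 ≤ x 0 ∧ 0 ≤ x 1 ∧ 0 ≤ x 2 ∧ x 0 + x 1 + x 2 ≤ 1}

theorem isClosed_corner : IsClosed corner := by
  have : corner = {x : Vec | 0 ≤ x 0} ∩ ({x | 0 ≤ x 1} ∩ ({x | 0 ≤ x 2} ∩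
      {x | x 0 + x 1 + x 2 ≤ 1})) := rfl
  rw [this]
  refine IsClosed.inter (isClosed_le (by fun_prop) (by fun_prop)) <|
    IsClosed.inter (isClosed_le (by fun_prop) (by fun_prop)) <|
    IsClosed.inter (isClosed_le (by fun_prop) (by fun_prop))
    (isClosed_le (by fun_prop) (by fun_prop))

theorem isCompact_corner : IsCompact corner := by
  refine (isCompact_Icc (a := (0 : Vec)) (b := 1)).of_isClosed_subset isClosed_corner ?_
  rintro x ⟨h0, h1, h2, h3⟩
  constructor <;> intro i <;> fin_cases i <;> simp <;> linarith

theorem measurableSet_corner : MeasurableSet corner := isClosed_corner.measurableSet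

theorem integrableOn_corner {φ : Vec → ℝ} (hφ : Continuous φ) : IntegrableOn φ corner :=
  hφ.continuousOn.integrableOn_compact isCompact_corner

/-- The volume of the corner simplex. -/
noncomputable def cornerVol : ℝ := volume.real corner

theorem cornerVol_pos : 0 < cornerVol := by
  have hsub : Set.Icc (0 : Vec) (fun _ => 1 / 3) ⊆ corner := by
    rintro x ⟨hx, hx'⟩
    have a0 := hx 0; have a1 := hx 1; have a2 := hx 2
    have b0 := hx' 0; have b1 := hx' 1; have b2 := hx' 2
    simp only [Pi.zero_apply] at a0 a1 a2
    exact ⟨a0, a1, a2, by linarith⟩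
  refine ENNReal.toReal_pos (fun h => ?_) isCompact_corner.measure_lt_top.ne
  have := measure_mono_null hsub h
  rw [Real.volume_Icc_pi] at this
  simp at this

/-- The point with barycentric coordinates `1 - x 0 - x 1 - x 2, x 0, x 1, x 2` relative to
`a, b, c, d`. -/
def bary (a b c d x : Vec) : Vec := (1 - x 0 - x 1 - x 2) • a + x 0 • b + x 1 • c + x 2 • d

theorem continuous_bary (a b c d : Vec) : Continuous (bary a b c d) := by
  unfold bary; fun_prop

/-- The integral of `φ` over the simplex with vertices `a, b, c, d`, with the volume of the simplex
normalised to `cornerVol`. -/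
noncomputable def simplexInt (a b c d : Vec) (φ : Vec → ℝ) : ℝ :=
  ∫ x in corner, φ (bary a b c d x)

theorem setIntegral_comp_involutive {s : Set Vec} (hs : MeasurableSet s)
    (M : Matrix (Fin 3) (Fin 3) ℝ) (v : Vec) (hM : |M.det| = 1)
    (f : Vec → Vec) (hf : ∀ x, f x = M.mulVec x + v) (hmaps : Set.MapsTo f s s)
    (hinv : Function.Involutive f) (φ : Vec → ℝ) :
    ∫ x in s, φ (f x) = ∫ x in s, φ x := by
  have himg : f '' s = s := by
    refine hmaps.image_subset.antisymm fun x hx => ⟨f x, hmaps hx, hinv x⟩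
  have hne : M.det ≠ 0 := fun h => by simp [h] at hM
  have := setIntegral_image_affine M v hne hf hs φ
  rw [himg, hM, one_mul] at this
  exact this.symm

theorem corner_integral_swap01 (φ : Vec → ℝ) :
    ∫ x in corner, φ ![x 1, x 0, x 2] = ∫ x in corner, φ x := by
  refine setIntegral_comp_involutive measurableSet_corner !![0, 1, 0; 1, 0, 0; 0, 0, 1] 0
    ?_ _ ?_ ?_ ?_ φ
  · simp [Matrix.det_fin_three]
  · intro x; ext i; fin_cases i <;> simp [dotProduct, Fin.sum_univ_three]
  · rintro x ⟨h0, h1, h2, h3⟩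
    exact ⟨by simpa, by simpa, by simpa, by simp; linarith⟩
  · intro x; ext i; fin_cases i <;> simp

theorem corner_integral_swap12 (φ : Vec → ℝ) :
    ∫ x in corner, φ ![x 0, x 2, x 1] = ∫ x in corner, φ x := by
  refine setIntegral_comp_involutive measurableSet_corner !![1, 0, 0; 0, 0, 1; 0, 1, 0] 0
    ?_ _ ?_ ?_ ?_ φ
  · simp [Matrix.det_fin_three]
  · intro x; ext i; fin_cases i <;> simp [dotProduct, Fin.sum_univ_three]
  · rintro x ⟨h0, h1, h2, h3⟩
    exact ⟨by simpa, by simpa, by simpa, by simp; linarith⟩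
  · intro x; ext i; fin_cases i <;> simp

theorem corner_integral_reflect (φ : Vec → ℝ) :
    ∫ x in corner, φ ![1 - x 0 - x 1 - x 2, x 1, x 2] = ∫ x in corner, φ x := by
  refine setIntegral_comp_involutive measurableSet_corner
    !![-1, -1, -1; 0, 1, 0; 0, 0, 1] ![1, 0, 0] ?_ _ ?_ ?_ ?_ φ
  · simp [Matrix.det_fin_three]
  · intro x; ext i; fin_cases i <;> simp [dotProduct, Fin.sum_univ_three]
    ring
  · rintro x ⟨h0, h1, h2, h3⟩
    exact ⟨by simp; linarith, by simpa, by simpa, by simp; linarith⟩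
  · intro x; ext i; fin_cases i <;> simp; ring

theorem simplexInt_swap_ab (a b c d : Vec) (φ : Vec → ℝ) :
    simplexInt b a c d φ = simplexInt a b c d φ := by
  unfold simplexInt
  rw [← corner_integral_reflect fun x => φ (bary a b c d x)]
  congr 1; ext x; congr 1; ext i; simp [bary]; ring

theorem simplexInt_swap_bc (a b c d : Vec) (φ : Vec → ℝ) :
    simplexInt a c b d φ = simplexInt a b c d φ := by
  unfold simplexInt
  rw [← corner_integral_swap01 fun x => φ (bary a b c d x)]
  congr 1; ext x; congr 1; ext i; simp [bary]; ring

theorem simplexInt_swap_cd (a b c d : Vec) (φ : Vec → ℝ) :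
    simplexInt a b d c φ = simplexInt a b c d φ := by
  unfold simplexInt
  rw [← corner_integral_swap12 fun x => φ (bary a b c d x)]
  congr 1; ext x; congr 1; ext i; simp [bary]; ring

theorem corner_integral_split {t : ℝ} (h0 : 0 < t) (h1 : t < 1) {φ : Vec → ℝ}
    (hφ : Continuous φ) :
    ∫ x in corner, φ x = t * (∫ x in corner, φ ![t * x 0, x 1, x 2]) +
      (1 - t) * ∫ x in corner, φ ![t * (1 - x 0 - x 1 - x 2) + x 0, x 1, x 2] := by
  have ht : 0 < 1 - t := by linarith
  set f : Vec → Vec := fun x => ![t * x 0, x 1, x 2] with hf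
  set g : Vec → Vec := fun x => ![t * (1 - x 0 - x 1 - x 2) + x 0, x 1, x 2] with hg
  have hfi : f '' corner = corner ∩ {x | 1 * x 0 + t * x 1 + t * x 2 ≤ t} := by
    apply Set.Subset.antisymm
    · rintro _ ⟨x, ⟨a0, a1, a2, a3⟩, rfl⟩
      refine ⟨⟨?_, ?_, ?_, ?_⟩, ?_⟩ <;> simp [hf] <;> nlinarith
    · rintro x ⟨⟨a0, a1, a2, a3⟩, a4⟩
      simp only [Set.mem_ofPred_eq] at a4
      refine ⟨![x 0 / t, x 1, x 2], ⟨?_, ?_, ?_, ?_⟩, ?_⟩ <;>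
        try (first | assumption | (simp; done))
      · simp only [Matrix.cons_val_zero]; positivity
      · have : x 0 / t ≤ 1 - x 1 - x 2 := by rw [div_le_iff₀ h0]; linarith
        simp; linarith
      · ext i; fin_cases i <;> simp [hf]; field_simp
  have hgi : g '' corner = corner ∩ {x | t ≤ 1 * x 0 + t * x 1 + t * x 2} := by
    apply Set.Subset.antisymm
    · rintro _ ⟨x, ⟨a0, a1, a2, a3⟩, rfl⟩
      refine ⟨⟨?_, ?_, ?_, ?_⟩, ?_⟩ <;> simp [hg] <;> nlinarith
    · rintro x ⟨⟨a0, a1, a2, a3⟩, a4⟩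
      simp only [Set.mem_ofPred_eq] at a4
      refine ⟨![(x 0 - t * (1 - x 1 - x 2)) / (1 - t), x 1, x 2], ⟨?_, ?_, ?_, ?_⟩, ?_⟩ <;>
        try (first | assumption | (simp; done))
      · exact div_nonneg (by linarith) ht.le
      · have : (x 0 - t * (1 - x 1 - x 2)) / (1 - t) ≤ 1 - x 1 - x 2 := by
          rw [div_le_iff₀ ht]; linarith
        simp; linarith
      · ext i; fin_cases i <;> simp [hg]; field_simp; ring
  have I1 := setIntegral_image_affine !![t, 0, 0; 0, 1, 0; 0, 0, 1] 0
    (by simp [Matrix.det_fin_three, h0.ne']) (f := f)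
    (by intro x; ext i; fin_cases i <;>
          simp [hf, dotProduct, Fin.sum_univ_three])
    measurableSet_corner φ
  have I2 := setIntegral_image_affine !![1 - t, -t, -t; 0, 1, 0; 0, 0, 1] ![t, 0, 0]
    (by simp [Matrix.det_fin_three, ht.ne']) (f := g)
    (by intro x; ext i; fin_cases i <;>
          simp [hg, dotProduct, Fin.sum_univ_three]
        ring)
    measurableSet_corner φ
  have d1 : |(!![t, 0, 0; 0, 1, 0; 0, 0, 1] : Matrix (Fin 3) (Fin 3) ℝ).det| = t := by
    simp [Matrix.det_fin_three, abs_of_pos h0]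
  have d2 : |(!![1 - t, -t, -t; 0, 1, 0; 0, 0, 1] : Matrix (Fin 3) (Fin 3) ℝ).det| = 1 - t := by
    simp [Matrix.det_fin_three, abs_of_pos ht]
  rw [d1, hfi] at I1
  rw [d2, hgi] at I2
  rw [← I1, ← I2]
  have hunion : corner = (corner ∩ {x | 1 * x 0 + t * x 1 + t * x 2 ≤ t}) ∪
      (corner ∩ {x | t ≤ 1 * x 0 + t * x 1 + t * x 2}) := by
    rw [← Set.inter_union_distrib_left]
    refine (Set.inter_eq_left.2 fun x _ => ?_).symm
    simpa using le_total (x 0 + t * x 1 + t * x 2) t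
  conv_lhs => rw [hunion]
  refine setIntegral_union₀ ?_ ?_ ?_ ?_
  · refine measure_mono_null ?_ (volume_plane_eq_zero 1 t t t (by simp))
    rintro x ⟨⟨_, h⟩, ⟨_, h'⟩⟩
    exact le_antisymm h h'
  · exact (measurableSet_corner.inter
      (measurableSet_le (by fun_prop) (by fun_prop))).nullMeasurableSet
  · exact (integrableOn_corner hφ).mono_set Set.inter_subset_left
  · exact (integrableOn_corner hφ).mono_set Set.inter_subset_left

/-- Cutting a simplex through a point `m` of the edge `a b` and the opposite edge. -/
theorem simplexInt_split (a b c d : Vec) {m : Vec} {t : ℝ} (h0 : 0 < t) (h1 : t < 1)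
    (hm : ∀ i, m i = (1 - t) * a i + t * b i) {φ : Vec → ℝ} (hφ : Continuous φ) :
    simplexInt a b c d φ = t * simplexInt a m c d φ + (1 - t) * simplexInt m b c d φ := by
  unfold simplexInt
  have key := corner_integral_split h0 h1 (φ := fun x => φ (bary a b c d x))
    (hφ.comp (continuous_bary a b c d))
  have e1 : ∀ x : Vec, bary a b c d ![t * x 0, x 1, x 2] = bary a m c d x := fun x => by
    ext i; simp [bary, hm]; ring
  have e2 : ∀ x : Vec, bary a b c d ![t * (1 - x 0 - x 1 - x 2) + x 0, x 1, x 2] =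
      bary m b c d x := fun x => by
    ext i; simp [bary, hm]; ring
  simpa only [e1, e2] using key

theorem corner_integral_coord (i : Fin 3) : ∫ x in corner, x i = cornerVol / 4 := by
  have e01 := corner_integral_swap01 fun x => x 0
  have e12 := corner_integral_swap12 fun x => x 1
  have er := corner_integral_reflect fun x => x 0
  simp only [Matrix.cons_val_zero, Matrix.cons_val_one] at e01 e12 er
  have i0 : IntegrableOn (fun x : Vec => x 0) corner := integrableOn_corner (by fun_prop)
  have i1 : IntegrableOn (fun x : Vec => x 1) corner := integrableOn_corner (by fun_prop)
  have i2 : IntegrableOn (fun x : Vec => x 2) corner := integrableOn_corner (by fun_prop)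
  have ic : IntegrableOn (fun _ : Vec => (1 : ℝ)) corner := integrableOn_corner (by fun_prop)
  have j0 : IntegrableOn (fun x : Vec => 1 - x 0) corner := integrableOn_corner (by fun_prop)
  have j1 : IntegrableOn (fun x : Vec => 1 - x 0 - x 1) corner :=
    integrableOn_corner (by fun_prop)
  rw [integral_sub j1 i2, integral_sub j0 i1, integral_sub ic i0] at er
  have hc : ∫ _ in corner, (1 : ℝ) = cornerVol := by simp [cornerVol]
  have h0 : ∫ x in corner, x 0 = cornerVol / 4 := by linarith
  fin_cases i <;> simp <;> linarith

theorem jensen_setIntegral {φ : Vec → ℝ} (hc : Continuous φ) (hφ : ConvexOn ℝ Set.univ φ)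
    {W s : Set Vec} (hs : IsCompact s) (hW : W ⊆ s) (hpos : 0 < volume.real W) (c : Vec)
    (hcent : ∀ i, ∫ x in W, x i = volume.real W * c i) :
    volume.real W * φ c ≤ ∫ x in W, φ x := by
  have htop : volume W ≠ ⊤ := (measure_mono hW |>.trans_lt hs.measure_lt_top).ne
  have h0 : volume W ≠ 0 := fun h => by simp [measureReal_def, h] at hpos
  have iφ : IntegrableOn φ W := (hc.continuousOn.integrableOn_compact hs).mono_set hW
  have iid : IntegrableOn (fun x : Vec => x) W :=
    (continuous_id.continuousOn.integrableOn_compact hs).mono_set hW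
  have key := hφ.map_set_average_le hc.continuousOn isClosed_univ h0 htop
    (Filter.Eventually.of_forall fun _ => Set.mem_univ _) iid iφ
  have hav : (⨍ x in W, x) = c := by
    ext i
    rw [setAverage_eq, Pi.smul_apply, eval_integral (fun i => ?_), hcent]
    · rw [smul_eq_mul]; field_simp
    · exact ((continuous_apply i).continuousOn.integrableOn_compact hs).mono_set hW
  rw [hav, setAverage_eq, smul_eq_mul, ← div_eq_inv_mul, le_div_iff₀ hpos] at key
  simpa [mul_comm] using key

theorem bary_combo (a b c d x y : Vec) {s t : ℝ} (hst : s + t = 1) :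
    bary a b c d (s • x + t • y) = s • bary a b c d x + t • bary a b c d y := by
  ext i
  obtain rfl : t = 1 - s := by linarith
  simp [bary]; ring

theorem bary_smul (a b c d x : Vec) (r : ℝ) :
    bary a b c d (r • x) = (1 - r) • a + r • bary a b c d x := by
  ext i; simp [bary]; ring

theorem jensen_simplexInt {φ : Vec → ℝ} (hc : Continuous φ) (hφ : ConvexOn ℝ Set.univ φ)
    (a b c d : Vec) : cornerVol * φ ((1 / 4 : ℝ) • (a + b + c + d)) ≤ simplexInt a b c d φ := by
  have hconv : ConvexOn ℝ Set.univ fun x => φ (bary a b c d x) := by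
    refine ⟨convex_univ, fun x _ y _ s t hs ht hst => ?_⟩
    simp only [bary_combo a b c d x y hst]
    exact hφ.2 (Set.mem_univ _) (Set.mem_univ _) hs ht hst
  have key := jensen_setIntegral (φ := fun x => φ (bary a b c d x))
    (hc.comp (continuous_bary a b c d)) hconv isCompact_corner
    subset_rfl cornerVol_pos (fun _ => 1 / 4) fun i => by
      rw [corner_integral_coord, cornerVol]; ring
  have e : bary a b c d (fun _ => 1 / 4) = (1 / 4 : ℝ) • (a + b + c + d) := by
    ext i; simp [bary]; ring
  simp only [e] at key
  exact key

theorem corner_integral_affine (α β γ δ : ℝ) :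
    ∫ x in corner, ((1 - x 0 - x 1 - x 2) * α + x 0 * β + x 1 * γ + x 2 * δ) =
      cornerVol / 4 * (α + β + γ + δ) := by
  have hrw : ∀ x : Vec, (1 - x 0 - x 1 - x 2) * α + x 0 * β + x 1 * γ + x 2 * δ =
      α + x 0 * (β - α) + x 1 * (γ - α) + x 2 * (δ - α) := fun x => by ring
  simp only [hrw]
  have hc : ∫ _ in corner, α = cornerVol * α := by simp [cornerVol]
  rw [integral_add (integrableOn_corner (by fun_prop)) (integrableOn_corner (by fun_prop)),
    integral_add (integrableOn_corner (by fun_prop)) (integrableOn_corner (by fun_prop)),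
    integral_add (integrableOn_corner (by fun_prop)) (integrableOn_corner (by fun_prop)),
    integral_mul_const, integral_mul_const, integral_mul_const, corner_integral_coord,
    corner_integral_coord, corner_integral_coord, hc]
  ring

theorem simplexInt_le {φ : Vec → ℝ} (hc : Continuous φ) (hφ : ConvexOn ℝ Set.univ φ)
    (a b c d : Vec) : simplexInt a b c d φ ≤ cornerVol / 4 * (φ a + φ b + φ c + φ d) := by
  rw [← corner_integral_affine]
  refine setIntegral_mono_on (integrableOn_corner (hc.comp (continuous_bary a b c d)))
    (integrableOn_corner (by fun_prop)) measurableSet_corner ?_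
  rintro x ⟨h0, h1, h2, h3⟩
  have := hφ.map_sum_le (t := Finset.univ) (w := ![1 - x 0 - x 1 - x 2, x 0, x 1, x 2])
    (p := ![a, b, c, d]) (by intro i _; fin_cases i <;> simp <;> linarith)
    (by simp [Fin.sum_univ_four]; ring) (by simp)
  simpa [Fin.sum_univ_four, bary] using this

/-- The square pyramid with base `|x| + |y| ≤ 1` and apex `(0, 0, 1)`. -/
def pyr : Set Vec := {x | |x 0| + |x 1| + x 2 ≤ 1 ∧ 0 ≤ x 2}

theorem isClosed_pyr : IsClosed pyr := by
  have : pyr = {x : Vec | |x 0| + |x 1| + x 2 ≤ 1} ∩ {x | 0 ≤ x 2} := rfl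
  rw [this]
  exact IsClosed.inter (isClosed_le (by fun_prop) (by fun_prop))
    (isClosed_le (by fun_prop) (by fun_prop))

theorem isCompact_pyr : IsCompact pyr := by
  refine (isCompact_Icc (a := (-1 : Vec)) (b := 1)).of_isClosed_subset isClosed_pyr ?_
  rintro x ⟨h1, h2⟩
  have a0 := abs_le.1 (show |x 0| ≤ 1 by linarith [abs_nonneg (x 1)])
  have a1 := abs_le.1 (show |x 1| ≤ 1 by linarith [abs_nonneg (x 0)])
  have := abs_nonneg (x 0)
  have := abs_nonneg (x 1)
  constructor <;> intro i <;> fin_cases i <;> simp <;> linarith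

theorem measurableSet_pyr : MeasurableSet pyr := isClosed_pyr.measurableSet

theorem integrableOn_pyr {φ : Vec → ℝ} (hφ : Continuous φ) : IntegrableOn φ pyr :=
  hφ.continuousOn.integrableOn_compact isCompact_pyr

theorem setIntegral_fold0 {s : Set Vec} (hs : MeasurableSet s)
    (hsym : ∀ x ∈ s, ![-x 0, x 1, x 2] ∈ s) {φ : Vec → ℝ} (hφ : IntegrableOn φ s) :
    ∫ x in s, φ x = (∫ x in s ∩ {x | 0 ≤ x 0}, φ x) +
      ∫ x in s ∩ {x | 0 ≤ x 0}, φ ![-x 0, x 1, x 2] := by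
  have hm : MeasurableSet (s ∩ {x | 0 ≤ x 0}) :=
    hs.inter (measurableSet_le (by fun_prop) (by fun_prop))
  have key := setIntegral_image_affine !![-1, 0, 0; 0, 1, 0; 0, 0, 1] 0
    (by simp [Matrix.det_fin_three]) (f := fun x => ![-x 0, x 1, x 2])
    (by intro x; ext i; fin_cases i <;> simp [dotProduct, Fin.sum_univ_three]) hm φ
  have himg : (fun x : Vec => (![-x 0, x 1, x 2] : Vec)) '' (s ∩ {x | 0 ≤ x 0}) =
      s ∩ {x | x 0 ≤ 0} := by
    apply Set.Subset.antisymm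
    · rintro _ ⟨x, ⟨h, h'⟩, rfl⟩
      exact ⟨hsym x h, by simpa using h'⟩
    · rintro x ⟨h, h'⟩
      exact ⟨_, ⟨hsym x h, by simpa using h'⟩, by ext i; fin_cases i <;> simp⟩
  rw [himg] at key
  have hdet : |(!![-1, 0, 0; 0, 1, 0; 0, 0, 1] : Matrix (Fin 3) (Fin 3) ℝ).det| = 1 := by
    simp [Matrix.det_fin_three]
  rw [hdet, one_mul] at key
  rw [← key, ← setIntegral_union₀]
  · rw [← Set.inter_union_distrib_left]
    congr 2
    refine (Set.inter_eq_left.2 fun x _ => ?_).symm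
    simpa using le_total 0 (x 0)
  · refine measure_mono_null ?_ (volume_plane_eq_zero 1 0 0 0 (by simp))
    rintro x ⟨⟨_, h⟩, ⟨_, h'⟩⟩
    simpa using le_antisymm h' h
  · exact (hs.inter (measurableSet_le (by fun_prop) (by fun_prop))).nullMeasurableSet
  · exact hφ.mono_set Set.inter_subset_left
  · exact hφ.mono_set Set.inter_subset_left

theorem setIntegral_fold1 {s : Set Vec} (hs : MeasurableSet s)
    (hsym : ∀ x ∈ s, ![x 0, -x 1, x 2] ∈ s) {φ : Vec → ℝ} (hφ : IntegrableOn φ s) :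
    ∫ x in s, φ x = (∫ x in s ∩ {x | 0 ≤ x 1}, φ x) +
      ∫ x in s ∩ {x | 0 ≤ x 1}, φ ![x 0, -x 1, x 2] := by
  have hm : MeasurableSet (s ∩ {x | 0 ≤ x 1}) :=
    hs.inter (measurableSet_le (by fun_prop) (by fun_prop))
  have key := setIntegral_image_affine !![1, 0, 0; 0, -1, 0; 0, 0, 1] 0
    (by simp [Matrix.det_fin_three]) (f := fun x => ![x 0, -x 1, x 2])
    (by intro x; ext i; fin_cases i <;> simp [dotProduct, Fin.sum_univ_three]) hm φ
  have himg : (fun x : Vec => (![x 0, -x 1, x 2] : Vec)) '' (s ∩ {x | 0 ≤ x 1}) =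
      s ∩ {x | x 1 ≤ 0} := by
    apply Set.Subset.antisymm
    · rintro _ ⟨x, ⟨h, h'⟩, rfl⟩
      exact ⟨hsym x h, by simpa using h'⟩
    · rintro x ⟨h, h'⟩
      exact ⟨_, ⟨hsym x h, by simpa using h'⟩, by ext i; fin_cases i <;> simp⟩
  rw [himg] at key
  have hdet : |(!![1, 0, 0; 0, -1, 0; 0, 0, 1] : Matrix (Fin 3) (Fin 3) ℝ).det| = 1 := by
    simp [Matrix.det_fin_three]
  rw [hdet, one_mul] at key
  rw [← key, ← setIntegral_union₀]
  · rw [← Set.inter_union_distrib_left]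
    congr 2
    refine (Set.inter_eq_left.2 fun x _ => ?_).symm
    simpa using le_total 0 (x 1)
  · refine measure_mono_null ?_ (volume_plane_eq_zero 0 1 0 0 (by simp))
    rintro x ⟨⟨_, h⟩, ⟨_, h'⟩⟩
    simpa using le_antisymm h' h
  · exact (hs.inter (measurableSet_le (by fun_prop) (by fun_prop))).nullMeasurableSet
  · exact hφ.mono_set Set.inter_subset_left
  · exact hφ.mono_set Set.inter_subset_left

theorem pyr_inter : pyr ∩ {x | 0 ≤ x 0} ∩ {x | 0 ≤ x 1} = corner := by
  ext x
  constructor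
  · rintro ⟨⟨⟨h1, h2⟩, h3⟩, h4⟩
    simp only [Set.mem_ofPred_eq] at h3 h4
    rw [abs_of_nonneg h3, abs_of_nonneg h4] at h1
    exact ⟨h3, h4, h2, h1⟩
  · rintro ⟨h0, h1, h2, h3⟩
    exact ⟨⟨⟨by rwa [abs_of_nonneg h0, abs_of_nonneg h1], h2⟩, h0⟩, h1⟩

/-- Splitting the pyramid along the two vertical coordinate planes. -/
theorem pyr_integral {φ : Vec → ℝ} (hφ : Continuous φ) :
    ∫ x in pyr, φ x = (∫ x in corner, φ ![x 0, x 1, x 2]) +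
      (∫ x in corner, φ ![-x 0, x 1, x 2]) + (∫ x in corner, φ ![x 0, -x 1, x 2]) +
      ∫ x in corner, φ ![-x 0, -x 1, x 2] := by
  have hm : MeasurableSet (pyr ∩ {x | 0 ≤ x 0}) :=
    measurableSet_pyr.inter (measurableSet_le (by fun_prop) (by fun_prop))
  have hsym : ∀ x ∈ pyr ∩ {x | 0 ≤ x 0}, ![x 0, -x 1, x 2] ∈ pyr ∩ {x : Vec | 0 ≤ x 0} := by
    rintro x ⟨⟨h1, h2⟩, h3⟩
    exact ⟨⟨by simpa using h1, by simpa using h2⟩, by simpa using h3⟩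
  have hφ' : Continuous fun x : Vec => φ ![-x 0, x 1, x 2] := by fun_prop
  rw [setIntegral_fold0 measurableSet_pyr _ (integrableOn_pyr hφ),
    setIntegral_fold1 hm hsym ((integrableOn_pyr hφ).mono_set Set.inter_subset_left),
    setIntegral_fold1 hm hsym ((integrableOn_pyr hφ').mono_set Set.inter_subset_left), pyr_inter]
  · have : ∀ x : Vec, ![x 0, x 1, x 2] = x := fun x => by ext i; fin_cases i <;> simp
    simp only [this, Matrix.cons_val_zero, Matrix.cons_val_one, Matrix.cons_val]
    ring
  · rintro x ⟨h1, h2⟩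
    exact ⟨by simpa using h1, by simpa using h2⟩

theorem volume_pyr : volume.real pyr = 4 * cornerVol := by
  have := pyr_integral (φ := fun _ => 1) (by fun_prop)
  simp at this
  rw [this, cornerVol]; ring

/-- The determinant with rows `u, v, w`. -/
def dt (u v w : Vec) : ℝ :=
  u 0 * (v 1 * w 2 - v 2 * w 1) - u 1 * (v 0 * w 2 - v 2 * w 0) + u 2 * (v 0 * w 1 - v 1 * w 0)

/-- Six times the volume of the simplex with vertices `a, b, c, d`. -/
def sixVol (a b c d : Vec) : ℝ := |dt (b - a) (c - a) (d - a)|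

theorem sixVol_nonneg (a b c d : Vec) : 0 ≤ sixVol a b c d := abs_nonneg _

theorem Continuous.sixVol {X : Type*} [TopologicalSpace X] {a b c d : X → Vec}
    (ha : Continuous a) (hb : Continuous b) (hc : Continuous c) (hd : Continuous d) :
    Continuous fun x => sixVol (a x) (b x) (c x) (d x) := by
  unfold _root_.sixVol dt
  simp only [Pi.sub_apply]
  fun_prop

theorem sixVol_swap12 (a b c d : Vec) : sixVol b a c d = sixVol a b c d := by
  unfold sixVol
  rw [← abs_neg]
  congr 1; simp [dt]; ring

theorem sixVol_swap23 (a b c d : Vec) : sixVol a c b d = sixVol a b c d := by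
  unfold sixVol
  rw [← abs_neg]
  congr 1; simp [dt]; ring

theorem sixVol_swap34 (a b c d : Vec) : sixVol a b d c = sixVol a b c d := by
  unfold sixVol
  rw [← abs_neg]
  congr 1; simp [dt]; ring

theorem convexOn_sixVol (b c d : Vec) : ConvexOn ℝ Set.univ fun a => sixVol a b c d := by
  refine ⟨convex_univ, fun x _ y _ s t hs ht hst => ?_⟩
  unfold sixVol
  have : dt (b - (s • x + t • y)) (c - (s • x + t • y)) (d - (s • x + t • y)) =
      s * dt (b - x) (c - x) (d - x) + t * dt (b - y) (c - y) (d - y) := by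
    obtain rfl : t = 1 - s := by linarith
    simp [dt]; ring
  simp only [this, smul_eq_mul]
  refine (abs_add_le _ _).trans_eq ?_
  rw [abs_mul, abs_mul, abs_of_nonneg hs, abs_of_nonneg ht]

theorem continuous_setIntegral {X : Type*} [TopologicalSpace X] [FirstCountableTopology X]
    [LocallyCompactSpace X] {A : Set Vec} (hA : IsCompact A) {F : X → Vec → ℝ}
    (hF : Continuous fun p : X × Vec => F p.1 p.2) : Continuous fun x => ∫ y in A, F x y :=
  continuous_parametric_integral_of_continuous hF hA

theorem convexOn_setIntegral {A : Set Vec} (hA : IsCompact A) {F : Vec → Vec → ℝ}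
    (hF : Continuous fun p : Vec × Vec => F p.1 p.2)
    (hc : ∀ y, ConvexOn ℝ Set.univ fun x => F x y) :
    ConvexOn ℝ Set.univ fun x => ∫ y in A, F x y := by
  have hi : ∀ x, IntegrableOn (F x) A := fun x =>
    (hF.comp (by fun_prop : Continuous fun y => (x, y))).continuousOn.integrableOn_compact hA
  refine ⟨convex_univ, fun x _ y _ s t hs ht hst => ?_⟩
  simp only [smul_eq_mul]
  rw [← integral_const_mul, ← integral_const_mul,
    ← integral_add ((hi x).const_mul s) ((hi y).const_mul t)]
  exact integral_mono (hi _) (((hi x).const_mul s).add ((hi y).const_mul t)) fun z =>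
    (hc z).2 (Set.mem_univ x) (Set.mem_univ y) hs ht hst

theorem setIntegral_mono_continuous {A : Set Vec} (hA : IsCompact A) {f g : Vec → ℝ}
    (hf : Continuous f) (hg : Continuous g) (h : ∀ x, f x ≤ g x) :
    ∫ x in A, f x ≤ ∫ x in A, g x :=
  integral_mono (hf.continuousOn.integrableOn_compact hA)
    (hg.continuousOn.integrableOn_compact hA) h

theorem setIntegral_mono_continuous_set {A B : Set Vec} (hB : IsCompact B) (hAB : A ⊆ B)
    {f : Vec → ℝ} (hf : Continuous f) (h : ∀ x, 0 ≤ f x) :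
    ∫ x in A, f x ≤ ∫ x in B, f x :=
  setIntegral_mono_set (hf.continuousOn.integrableOn_compact hB)
    (Filter.Eventually.of_forall h) hAB.eventuallyLE

theorem setIntegral_swap {A B : Set Vec} (hA : IsCompact A) (hB : IsCompact B)
    {F : Vec → Vec → ℝ} (hF : Continuous fun p : Vec × Vec => F p.1 p.2) :
    ∫ x in A, ∫ y in B, F x y = ∫ y in B, ∫ x in A, F x y := by
  refine integral_integral_swap ?_
  rw [Measure.prod_restrict]
  exact hF.continuousOn.integrableOn_compact (hA.prod hB)

/-- The integral of `sixVol a` over `A × B × C`. -/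
noncomputable def vInt (A B C : Set Vec) (a : Vec) : ℝ :=
  ∫ b in A, ∫ c in B, ∫ d in C, sixVol a b c d

section vInt

variable {A B C E A' B' C' K L : Set Vec}

theorem continuous_vInt_inner (hC : IsCompact C) :
    Continuous fun p : (Vec × Vec) × Vec => ∫ d in C, sixVol p.1.1 p.1.2 p.2 d :=
  continuous_setIntegral hC (.sixVol (by fun_prop) (by fun_prop) (by fun_prop) (by fun_prop))

theorem continuous_vInt_mid (hB : IsCompact B) (hC : IsCompact C) :
    Continuous fun p : Vec × Vec => ∫ c in B, ∫ d in C, sixVol p.1 p.2 c d :=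
  continuous_setIntegral hB (F := fun (p : Vec × Vec) c => ∫ d in C, sixVol p.1 p.2 c d)
    (continuous_vInt_inner hC)

theorem continuous_vInt (hA : IsCompact A) (hB : IsCompact B) (hC : IsCompact C) :
    Continuous (vInt A B C) :=
  continuous_setIntegral hA (F := fun a b => ∫ c in B, ∫ d in C, sixVol a b c d)
    (continuous_vInt_mid hB hC)

theorem convexOn_vInt (hA : IsCompact A) (hB : IsCompact B) (hC : IsCompact C) :
    ConvexOn ℝ Set.univ (vInt A B C) := by
  refine convexOn_setIntegral hA (F := fun a b => ∫ c in B, ∫ d in C, sixVol a b c d)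
    (continuous_vInt_mid hB hC) fun b => ?_
  refine convexOn_setIntegral hB (F := fun a c => ∫ d in C, sixVol a b c d)
    ((continuous_vInt_inner hC).comp
      (by fun_prop : Continuous fun p : Vec × Vec => ((p.1, b), p.2))) fun c => ?_
  exact convexOn_setIntegral hC (F := fun a d => sixVol a b c d)
    (.sixVol (by fun_prop) (by fun_prop) (by fun_prop) (by fun_prop)) fun d =>
      convexOn_sixVol b c d

theorem vInt_mono (hA : IsCompact A) (hB : IsCompact B) (hC : IsCompact C)
    (hA' : IsCompact A') (hB' : IsCompact B') (hC' : IsCompact C')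
    (hAA : A ⊆ A') (hBB : B ⊆ B') (hCC : C ⊆ C') (a : Vec) :
    vInt A B C a ≤ vInt A' B' C' a := by
  have hin (C : Set Vec) (hC : IsCompact C) (b : Vec) :
      Continuous fun c => ∫ d in C, sixVol a b c d :=
    (continuous_vInt_inner hC).comp (by fun_prop : Continuous fun c : Vec => ((a, b), c))
  have hmid (B C : Set Vec) (hB : IsCompact B) (hC : IsCompact C) :
      Continuous fun b => ∫ c in B, ∫ d in C, sixVol a b c d :=
    (continuous_vInt_mid hB hC).comp (by fun_prop : Continuous fun b : Vec => (a, b))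
  have n1 (C : Set Vec) (b c : Vec) : 0 ≤ ∫ d in C, sixVol a b c d :=
    integral_nonneg fun _ => sixVol_nonneg _ _ _ _
  refine (setIntegral_mono_continuous hA (hmid B C hB hC) (hmid B' C' hB' hC') fun b => ?_).trans
    (setIntegral_mono_continuous_set hA' hAA (hmid B' C' hB' hC') fun b =>
      integral_nonneg fun _ => n1 _ _ _)
  refine (setIntegral_mono_continuous hB (hin C hC b) (hin C' hC' b) fun c => ?_).trans
    (setIntegral_mono_continuous_set hB' hBB (hin C' hC' b) fun c => n1 _ _ _)
  exact setIntegral_mono_continuous_set hC' hCC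
    (.sixVol (by fun_prop) (by fun_prop) (by fun_prop) (by fun_prop)) fun _ =>
      sixVol_nonneg _ _ _ _

theorem vInt_nonneg (A B C : Set Vec) (a : Vec) : 0 ≤ vInt A B C a :=
  integral_nonneg fun _ => integral_nonneg fun _ => integral_nonneg fun _ =>
    sixVol_nonneg _ _ _ _

theorem integral_vInt_swap12 (hA : IsCompact A) (hB : IsCompact B) (hC : IsCompact C)
    (hE : IsCompact E) : ∫ a in A, vInt B C E a = ∫ a in B, vInt A C E a := by
  unfold vInt
  rw [setIntegral_swap hA hB (continuous_vInt_mid hC hE)]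
  simp only [sixVol_swap12]

theorem integral_vInt_swap23 (hB : IsCompact B) (hC : IsCompact C)
    (hE : IsCompact E) : ∫ a in A, vInt B C E a = ∫ a in A, vInt C B E a := by
  unfold vInt
  congr 1; ext a
  rw [setIntegral_swap hB hC (F := fun b c => ∫ d in E, sixVol a b c d)
    ((continuous_vInt_inner hE).comp
      (by fun_prop : Continuous fun p : Vec × Vec => ((a, p.1), p.2)))]
  simp only [sixVol_swap23]

theorem integral_vInt_swap34 (hC : IsCompact C)
    (hE : IsCompact E) : ∫ a in A, vInt B C E a = ∫ a in A, vInt B E C a := by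
  unfold vInt
  congr 1; ext a; congr 1; ext b
  rw [setIntegral_swap hC hE
    (.sixVol (by fun_prop) (by fun_prop) (by fun_prop) (by fun_prop))]
  simp only [sixVol_swap34]

/-- The integral of `sixVol` over quadruples of points of `A`. -/
noncomputable def totalInt (A : Set Vec) : ℝ := ∫ a in A, vInt A A A a

theorem totalInt_sub (hK : IsCompact K) (hL : IsCompact L) (hLK : L ⊆ K) :
    totalInt K - totalInt L = (∫ a in K \ L, vInt K K K a) + (∫ a in K \ L, vInt L K K a) +
      (∫ a in K \ L, vInt L L K a) + ∫ a in K \ L, vInt L L L a := by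
  have hd (X Y Z : Set Vec) (hX : IsCompact X) (hY : IsCompact Y) (hZ : IsCompact Z) :
      ∫ a in K \ L, vInt X Y Z a = (∫ a in K, vInt X Y Z a) - ∫ a in L, vInt X Y Z a :=
    setIntegral_sdiff hL.measurableSet
      ((continuous_vInt hX hY hZ).continuousOn.integrableOn_compact hK) hLK
  rw [hd _ _ _ hK hK hK, hd _ _ _ hL hK hK, hd _ _ _ hL hL hK, hd _ _ _ hL hL hL]
  have e1 := integral_vInt_swap12 hL hK hK hK
  have e2 := (integral_vInt_swap23 (A := L) hL hK hK).trans (integral_vInt_swap12 hL hK hL hK)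
  have e3 := ((integral_vInt_swap34 (A := L) (B := L) hL hK).trans
    (integral_vInt_swap23 (A := L) hL hK hL)).trans (integral_vInt_swap12 hL hK hL hL)
  unfold totalInt
  linarith

theorem totalInt_sub_le (hK : IsCompact K) (hL : IsCompact L) (hLK : L ⊆ K) {G : ℝ}
    (hG : ∀ a ∈ K \ L, vInt K K K a ≤ G) :
    totalInt K - totalInt L ≤ 4 * volume.real (K \ L) * G := by
  have hm : MeasurableSet (K \ L) := hK.measurableSet.diff hL.measurableSet
  have hfin : volume (K \ L) ≠ ⊤ :=
    ((measure_mono Set.sdiff_subset).trans_lt hK.measure_lt_top).ne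
  have hb (X Y Z : Set Vec) (hX : IsCompact X) (hY : IsCompact Y) (hZ : IsCompact Z)
      (hXK : X ⊆ K) (hYK : Y ⊆ K) (hZK : Z ⊆ K) :
      ∫ a in K \ L, vInt X Y Z a ≤ volume.real (K \ L) * G := by
    have := setIntegral_mono_on (μ := volume) (s := K \ L) (f := vInt X Y Z) (g := fun _ => G)
      (((continuous_vInt hX hY hZ).continuousOn.integrableOn_compact hK).mono_set
        Set.sdiff_subset) (integrableOn_const hfin) hm
      fun a ha => (vInt_mono hX hY hZ hK hK hK hXK hYK hZK a).trans (hG a ha)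
    simpa using this
  rw [totalInt_sub hK hL hLK]
  linarith [hb _ _ _ hK hK hK subset_rfl subset_rfl subset_rfl,
    hb _ _ _ hL hK hK hLK subset_rfl subset_rfl, hb _ _ _ hL hL hK hLK hLK subset_rfl,
    hb _ _ _ hL hL hL hLK hLK hLK]

theorem le_totalInt_sub (hK : IsCompact K) (hL : IsCompact L) (hLK : L ⊆ K) :
    4 * ∫ a in K \ L, vInt L L L a ≤ totalInt K - totalInt L := by
  have hm : MeasurableSet (K \ L) := hK.measurableSet.diff hL.measurableSet
  have hb (X Y Z : Set Vec) (hX : IsCompact X) (hY : IsCompact Y) (hZ : IsCompact Z)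
      (hXK : L ⊆ X) (hYK : L ⊆ Y) (hZK : L ⊆ Z) :
      ∫ a in K \ L, vInt L L L a ≤ ∫ a in K \ L, vInt X Y Z a :=
    setIntegral_mono_on
      (((continuous_vInt hL hL hL).continuousOn.integrableOn_compact hK).mono_set
        Set.sdiff_subset)
      (((continuous_vInt hX hY hZ).continuousOn.integrableOn_compact hK).mono_set
        Set.sdiff_subset) hm
      fun a _ => vInt_mono hL hL hL hX hY hZ hXK hYK hZK a
  rw [totalInt_sub hK hL hLK]
  linarith [hb _ _ _ hK hK hK hLK hLK hLK,
    hb _ _ _ hL hK hK subset_rfl hLK hLK, hb _ _ _ hL hL hK subset_rfl subset_rfl hLK]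

theorem totalInt_mono (hK : IsCompact K) (hL : IsCompact L) (hLK : L ⊆ K) :
    totalInt L ≤ totalInt K := by
  have := le_totalInt_sub hK hL hLK
  have : 0 ≤ ∫ a in K \ L, vInt L L L a := integral_nonneg fun _ => vInt_nonneg _ _ _ _
  linarith

theorem setIntegral_image_homothety {r : ℝ} (hr : 0 < r) (p : Vec) (hA : IsCompact A)
    (φ : Vec → ℝ) : ∫ x in (fun x => p + r • x) '' A, φ x = r ^ 3 * ∫ x in A, φ (p + r • x) := by
  have := setIntegral_image_affine (r • (1 : Matrix (Fin 3) (Fin 3) ℝ)) p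
    (by simp [hr.ne']) (f := fun x => p + r • x)
    (by intro x; rw [Matrix.smul_mulVec, Matrix.one_mulVec, add_comm]) hA.measurableSet φ
  rw [this]
  simp [abs_of_pos hr]

/-- The map `x ↦ p + r • x` scales `vInt` by `r ^ 12`. -/
theorem vInt_image_homothety {r : ℝ} (hr : 0 < r) (p : Vec) (hA : IsCompact A) (a : Vec) :
    vInt ((fun x => p + r • x) '' A) ((fun x => p + r • x) '' A) ((fun x => p + r • x) '' A)
      (p + r • a) = r ^ 12 * vInt A A A a := by
  have hs (b c d : Vec) : sixVol (p + r • a) (p + r • b) (p + r • c) (p + r • d) =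
      r ^ 3 * sixVol a b c d := by
    unfold sixVol
    rw [← abs_of_pos (pow_pos hr 3), ← abs_mul]
    congr 1; simp [dt]; ring
  unfold vInt
  simp only [setIntegral_image_homothety hr p hA, hs, integral_const_mul]
  ring

theorem totalInt_image_homothety {r : ℝ} (hr : 0 < r) (p : Vec) (hA : IsCompact A) :
    totalInt ((fun x => p + r • x) '' A) = r ^ 15 * totalInt A := by
  unfold totalInt
  rw [setIntegral_image_homothety hr p hA]
  simp only [vInt_image_homothety hr p hA, integral_const_mul]
  ring

end vInt

/-- The integral of `sixVol a` over triples of points of the pyramid. -/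
noncomputable def pyrInt (a : Vec) : ℝ := vInt pyr pyr pyr a

theorem continuous_pyrInt : Continuous pyrInt :=
  continuous_vInt isCompact_pyr isCompact_pyr isCompact_pyr

theorem convexOn_pyrInt : ConvexOn ℝ Set.univ pyrInt :=
  convexOn_vInt isCompact_pyr isCompact_pyr isCompact_pyr

theorem pyr_integral_flip0 (φ : Vec → ℝ) :
    ∫ x in pyr, φ ![-x 0, x 1, x 2] = ∫ x in pyr, φ x := by
  refine setIntegral_comp_involutive measurableSet_pyr
    !![-1, 0, 0; 0, 1, 0; 0, 0, 1] 0 ?_ _ ?_ ?_ ?_ φ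
  · simp [Matrix.det_fin_three]
  · intro x; ext i; fin_cases i <;> simp [dotProduct, Fin.sum_univ_three]
  · rintro x ⟨h0, h1⟩
    exact ⟨by simpa using h0, by simpa using h1⟩
  · intro x; ext i; fin_cases i <;> simp

theorem pyr_integral_flip1 (φ : Vec → ℝ) :
    ∫ x in pyr, φ ![x 0, -x 1, x 2] = ∫ x in pyr, φ x := by
  refine setIntegral_comp_involutive measurableSet_pyr
    !![1, 0, 0; 0, -1, 0; 0, 0, 1] 0 ?_ _ ?_ ?_ ?_ φ
  · simp [Matrix.det_fin_three]
  · intro x; ext i; fin_cases i <;> simp [dotProduct, Fin.sum_univ_three]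
  · rintro x ⟨h0, h1⟩
    exact ⟨by simpa using h0, by simpa using h1⟩
  · intro x; ext i; fin_cases i <;> simp

theorem pyr_integral_swap01 (φ : Vec → ℝ) :
    ∫ x in pyr, φ ![x 1, x 0, x 2] = ∫ x in pyr, φ x := by
  refine setIntegral_comp_involutive measurableSet_pyr
    !![0, 1, 0; 1, 0, 0; 0, 0, 1] 0 ?_ _ ?_ ?_ ?_ φ
  · simp [Matrix.det_fin_three]
  · intro x; ext i; fin_cases i <;> simp [dotProduct, Fin.sum_univ_three]
  · rintro x ⟨h0, h1⟩
    exact ⟨by simpa [add_comm] using h0, by simpa using h1⟩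
  · intro x; ext i; fin_cases i <;> simp

theorem pyrInt_comp {f : Vec → Vec} (hf : ∀ φ : Vec → ℝ, ∫ x in pyr, φ (f x) = ∫ x in pyr, φ x)
    (hs : ∀ a b c d, sixVol (f a) (f b) (f c) (f d) = sixVol a b c d) (a : Vec) :
    pyrInt (f a) = pyrInt a := by
  unfold pyrInt vInt
  rw [← hf]
  congr 1; ext b
  rw [← hf]
  congr 1; ext c
  rw [← hf]
  simp only [hs]

theorem pyrInt_flip0 (a : Vec) : pyrInt ![-a 0, a 1, a 2] = pyrInt a :=
  pyrInt_comp (f := fun x => ![-x 0, x 1, x 2]) pyr_integral_flip0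
    (fun a b c d => by unfold sixVol; rw [← abs_neg]; congr 1; simp [dt]; ring) a

theorem pyrInt_flip1 (a : Vec) : pyrInt ![a 0, -a 1, a 2] = pyrInt a :=
  pyrInt_comp (f := fun x => ![x 0, -x 1, x 2]) pyr_integral_flip1
    (fun a b c d => by unfold sixVol; rw [← abs_neg]; congr 1; simp [dt]; ring) a

theorem pyrInt_swap01 (a : Vec) : pyrInt ![a 1, a 0, a 2] = pyrInt a :=
  pyrInt_comp (f := fun x => ![x 1, x 0, x 2]) pyr_integral_swap01
    (fun a b c d => by unfold sixVol; rw [← abs_neg]; congr 1; simp [dt]; ring) a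

theorem pyr_integral_of_even {φ : Vec → ℝ} (hc : Continuous φ)
    (h0 : ∀ x : Vec, φ ![-x 0, x 1, x 2] = φ x) (h1 : ∀ x : Vec, φ ![x 0, -x 1, x 2] = φ x) :
    ∫ x in pyr, φ x = 4 * ∫ x in corner, φ x := by
  have h : ∀ x : Vec, ![x 0, x 1, x 2] = x := fun x => by ext i; fin_cases i <;> simp
  have h01 : ∀ x : Vec, φ ![-x 0, -x 1, x 2] = φ x := fun x => by
    rw [← h1 x, ← h0]; simp
  rw [pyr_integral hc]
  simp only [h, h0, h1, h01]
  ring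

theorem corner_integral_eq_simplexInt (φ : Vec → ℝ) :
    ∫ x in corner, φ x = simplexInt ![0, 0, 0] ![1, 0, 0] ![0, 1, 0] ![0, 0, 1] φ := by
  unfold simplexInt
  congr 1; ext x; congr 1; ext i; fin_cases i <;> simp [bary]

theorem simplexInt_rotate (a b c d : Vec) (φ : Vec → ℝ) :
    simplexInt c d b a φ = simplexInt a b c d φ := by
  rw [simplexInt_swap_bc c b d a, simplexInt_swap_ab b c d a, simplexInt_swap_cd b c a d,
    simplexInt_swap_bc b a c d, simplexInt_swap_ab]

theorem pyr_integral_of_symm {φ : Vec → ℝ} (hc : Continuous φ)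
    (h0 : ∀ x : Vec, φ ![-x 0, x 1, x 2] = φ x) (h1 : ∀ x : Vec, φ ![x 0, -x 1, x 2] = φ x)
    (h2 : ∀ x : Vec, φ ![x 1, x 0, x 2] = φ x) :
    ∫ x in pyr, φ x =
      4 * simplexInt ![0, 0, 1] ![0, 0, 0] ![1, 0, 0] ![1 / 2, 1 / 2, 0] φ := by
  rw [pyr_integral_of_even hc h0 h1, corner_integral_eq_simplexInt, ← simplexInt_swap_ab,
    ← simplexInt_swap_bc, simplexInt_split _ _ _ _ (m := ![1 / 2, 1 / 2, 0]) (t := 1 / 2)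
      (by norm_num) (by norm_num) (by intro i; fin_cases i <;> norm_num) hc]
  have e1 : simplexInt ![1 / 2, 1 / 2, 0] ![0, 1, 0] ![0, 0, 0] ![0, 0, 1] φ =
      simplexInt ![1 / 2, 1 / 2, 0] ![1, 0, 0] ![0, 0, 0] ![0, 0, 1] φ := by
    unfold simplexInt
    congr 1; ext x
    rw [← h2]
    congr 1; ext i; fin_cases i <;> simp [bary]
  rw [e1, simplexInt_swap_ab ![1, 0, 0] ![1 / 2, 1 / 2, 0], simplexInt_rotate]
  ring

theorem crofton_step {r : ℝ} (h0 : 0 < r) (h1 : r < 1) :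
    16 * cornerVol * (1 + r + r ^ 2) * r ^ 12 *
      pyrInt (bary ![0, 0, 1] ![0, 0, 0] ![1, 0, 0] ![1 / 2, 1 / 2, 0]
        (fun _ => (1 + r + r ^ 2 + r ^ 3) / (4 * r * (1 + r + r ^ 2)))) ≤
      (∑ i ∈ Finset.range 15, r ^ i) * totalInt pyr := by
  set e : Vec := ![0, 0, 1] with he
  have e0 : e 0 = 0 := rfl
  have e1 : e 1 = 0 := rfl
  have e2 : e 2 = 1 := rfl
  clear_value e
  set h : Vec → Vec := fun x => (1 - r) • e + r • x with hh
  set Pr : Set Vec := h '' pyr with hPr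
  have hPc : IsCompact Pr := isCompact_pyr.image (by fun_prop)
  have hsub : Pr ⊆ pyr := by
    rintro _ ⟨x, ⟨a0, a1⟩, rfl⟩
    refine ⟨?_, ?_⟩
    · simp [hh, e0, e1, e2, abs_mul, abs_of_pos h0]; nlinarith
    · simp [hh, e2]; nlinarith
  set φ : Vec → ℝ := fun q => r ^ 12 * pyrInt (e + r⁻¹ • (q - e)) with hφ
  have hφv : ∀ q, vInt Pr Pr Pr q = φ q := fun q => by
    have := vInt_image_homothety h0 ((1 - r) • e) isCompact_pyr (e + r⁻¹ • (q - e))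
    simp only [hφ, pyrInt]
    rw [← this]
    congr 1
    ext i; simp; field_simp; ring
  have hφc : Continuous φ := by
    have := continuous_pyrInt
    fun_prop
  have hφh : ∀ x, φ (h x) = r ^ 12 * pyrInt x := fun x => by
    simp only [hφ]
    congr 2
    ext i; simp [hh]; field_simp; ring
  have hφconv : ConvexOn ℝ Set.univ φ := by
    have : φ = vInt Pr Pr Pr := funext fun q => (hφv q).symm
    rw [this]
    exact convexOn_vInt hPc hPc hPc
  have s0 : ∀ x : Vec, φ ![-x 0, x 1, x 2] = φ x := fun x => by
    simp only [hφ]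
    rw [← pyrInt_flip0]
    congr 2; ext i; fin_cases i <;> simp [e0, e1, e2, Matrix.vecHead, Matrix.vecTail]
  have s1 : ∀ x : Vec, φ ![x 0, -x 1, x 2] = φ x := fun x => by
    simp only [hφ]
    rw [← pyrInt_flip1]
    congr 2; ext i; fin_cases i <;> simp [e0, e1, e2, Matrix.vecHead, Matrix.vecTail]
  have s2 : ∀ x : Vec, φ ![x 1, x 0, x 2] = φ x := fun x => by
    simp only [hφ]
    rw [← pyrInt_swap01]
    congr 2; ext i; fin_cases i <;> simp [e0, e1, e2, Matrix.vecHead, Matrix.vecTail]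
  set B := bary e ![0, 0, 0] ![1, 0, 0] ![1 / 2, 1 / 2, 0] with hB
  have hBc : Continuous B := continuous_bary _ _ _ _
  have hBh : ∀ x : Vec, h (B x) = B (r • x) := fun x =>
    (bary_smul _ _ _ _ _ _).symm
  set ψ : Vec → ℝ := fun x => φ (B x) with hψ
  have hψc : Continuous ψ := hφc.comp hBc
  set D : Set Vec := (fun x => 0 + r • x) '' corner with hD
  have hDc : IsCompact D := isCompact_corner.image (by fun_prop)
  have hDsub : D ⊆ corner := by
    rintro _ ⟨x, ⟨a0, a1, a2, a3⟩, rfl⟩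
    refine ⟨?_, ?_, ?_, ?_⟩ <;> simp <;> nlinarith
  have hdiff (f : Vec → ℝ) (hf : Continuous f) : ∫ x in corner \ D, f x =
      (∫ x in corner, f x) - r ^ 3 * ∫ x in corner, f (r • x) := by
    rw [setIntegral_sdiff hDc.measurableSet (integrableOn_corner hf) hDsub, hD,
      setIntegral_image_homothety h0 0 isCompact_corner]
    simp only [zero_add]
  have hvol : volume.real (corner \ D) = cornerVol * (1 - r ^ 3) := by
    have := hdiff (fun _ => 1) (by fun_prop)
    simp at this
    rw [this, cornerVol]; ring
  have hq : 0 < 1 + r + r ^ 2 := by positivity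
  have hr3 : 1 - r ^ 3 = (1 - r) * (1 + r + r ^ 2) := by ring
  have hpos : 0 < volume.real (corner \ D) := by
    rw [hvol, hr3]
    have := cornerVol_pos
    have : 0 < 1 - r := by linarith
    positivity
  have hJ := jensen_setIntegral (φ := ψ) (W := corner \ D) hψc ?_ isCompact_corner
    Set.sdiff_subset hpos (fun _ => (1 + r + r ^ 2 + r ^ 3) / (4 * (1 + r + r ^ 2))) ?_
  rotate_left
  · refine ⟨convex_univ, fun x _ y _ s t hs ht hst => ?_⟩
    simp only [hψ, hB, bary_combo _ _ _ _ x y hst]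
    exact hφconv.2 (Set.mem_univ _) (Set.mem_univ _) hs ht hst
  · intro i
    rw [hdiff _ (by fun_prop), hvol, hr3]
    simp only [Pi.smul_apply, smul_eq_mul, integral_const_mul, corner_integral_coord]
    field_simp
    ring
  have hcompl : ∫ a in pyr \ Pr, vInt Pr Pr Pr a = 4 * ∫ x in corner \ D, ψ x := by
    simp only [hφv]
    rw [setIntegral_sdiff hPc.measurableSet (integrableOn_pyr hφc) hsub, hPr, hh,
      setIntegral_image_homothety h0 _ isCompact_pyr, hdiff _ hψc,
      pyr_integral_of_symm hφc s0 s1 s2]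
    have : ∫ x in pyr, φ (h x) = 4 * ∫ x in corner, ψ (r • x) := by
      simp only [hφh]
      rw [pyr_integral_of_symm (by have := continuous_pyrInt; fun_prop)
        (fun x => by rw [pyrInt_flip0]) (fun x => by rw [pyrInt_flip1])
        (fun x => by rw [pyrInt_swap01])]
      simp only [hψ, ← hBh, hφh, ← he, simplexInt]
      rw [hB]
    simp only [hh] at this
    rw [this]
    simp only [simplexInt, hψ, hB, ← he]
    ring
  have hle := le_totalInt_sub isCompact_pyr hPc hsub
  rw [hcompl, hPr, hh, totalInt_image_homothety h0 _ isCompact_pyr] at hle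
  have hψv : ψ (fun _ => (1 + r + r ^ 2 + r ^ 3) / (4 * (1 + r + r ^ 2))) =
      r ^ 12 * pyrInt (B fun _ => (1 + r + r ^ 2 + r ^ 3) / (4 * r * (1 + r + r ^ 2))) := by
    rw [← hφh, hBh]
    simp only [hψ]
    congr 2; ext i; simp; field_simp
  rw [hψv, hvol, hr3] at hJ
  have hgeom : (∑ i ∈ Finset.range 15, r ^ i) * (1 - r) = 1 - r ^ 15 := by
    simp only [Finset.sum_range_succ, Finset.sum_range_zero]; ring
  have h1r : 0 < 1 - r := by linarith
  refine le_of_mul_le_mul_right ?_ h1r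
  calc _ = 16 * (cornerVol * ((1 - r) * (1 + r + r ^ 2)) * (r ^ 12 *
        pyrInt (B fun _ => (1 + r + r ^ 2 + r ^ 3) / (4 * r * (1 + r + r ^ 2))))) := by ring
    _ ≤ totalInt pyr - r ^ 15 * totalInt pyr := by linarith
    _ = _ := by linear_combination (-totalInt pyr) * hgeom

theorem crofton_bound : 48 * cornerVol * pyrInt ![1 / 2, 1 / 6, 0] ≤ 15 * totalInt pyr := by
  have hc := continuous_pyrInt
  have hb := continuous_bary ![0, 0, 1] ![0, 0, 0] ![1, 0, 0] ![1 / 2, 1 / 2, 0]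
  have l1 : ContinuousAt (fun r : ℝ => 16 * cornerVol * (1 + r + r ^ 2) * r ^ 12 *
      pyrInt (bary ![0, 0, 1] ![0, 0, 0] ![1, 0, 0] ![1 / 2, 1 / 2, 0]
        (fun _ => (1 + r + r ^ 2 + r ^ 3) / (4 * r * (1 + r + r ^ 2))))) 1 := by
    refine ContinuousAt.mul (by fun_prop) ?_
    refine hc.continuousAt.comp (hb.continuousAt.comp ?_)
    refine continuousAt_pi.2 fun _ => ContinuousAt.div (by fun_prop) (by fun_prop) (by norm_num)
  have l2 : ContinuousAt (fun r : ℝ => (∑ i ∈ Finset.range 15, r ^ i) * totalInt pyr) 1 := by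
    fun_prop
  have hev : ∀ᶠ r : ℝ in nhdsWithin 1 (Set.Iio 1), 0 < r ∧ r < 1 := by
    filter_upwards [self_mem_nhdsWithin, Ioo_mem_nhdsLT (show (0 : ℝ) < 1 by norm_num)]
      with r h1 h2 using ⟨h2.1, h1⟩
  have := le_of_tendsto_of_tendsto (l1.tendsto.mono_left nhdsWithin_le_nhds)
    (l2.tendsto.mono_left (nhdsWithin_le_nhds (s := Set.Iio 1)))
    (hev.mono fun r hr => crofton_step hr.1 hr.2)
  norm_num at this
  have hy : (bary ![0, 0, 1] ![0, 0, 0] ![1, 0, 0] ![1 / 2, 1 / 2, 0] fun _ => 1 / 3) =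
      ![1 / 2, 1 / 6, 0] := by
    ext i; fin_cases i <;> norm_num [bary]
  norm_num [hy] at this ⊢
  linarith

/-- The standard simplex as a convex hull. -/
def stdHull : Set Vec := convexHull ℝ {![0, 0, 0], ![1, 0, 0], ![0, 1, 0], ![0, 0, 1]}

theorem volume_stdHull_pos : 0 < volume.real stdHull := by
  have hsub : corner ⊆ stdHull := by
    rintro x ⟨h0, h1, h2, h3⟩
    have := (convex_convexHull ℝ ({![0, 0, 0], ![1, 0, 0], ![0, 1, 0], ![0, 0, 1]} :
      Set Vec)).sum_mem (t := Finset.univ) (w := ![1 - x 0 - x 1 - x 2, x 0, x 1, x 2])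
      (z := ![![0, 0, 0], ![1, 0, 0], ![0, 1, 0], ![0, 0, 1]])
      (by intro i _; fin_cases i <;> simp <;> linarith) (by simp [Fin.sum_univ_four]; ring)
      (by intro i _; fin_cases i <;> exact subset_convexHull _ _ (by simp))
    refine Set.mem_of_eq_of_mem ?_ this
    ext i; fin_cases i <;> simp [Fin.sum_univ_four]
  have hc : IsCompact stdHull := by
    unfold stdHull
    exact Set.Finite.isCompact_convexHull ℝ (Set.toFinite _)
  exact cornerVol_pos.trans_le (measureReal_mono hsub hc.measure_lt_top.ne)

theorem volume_convexHull_four (a b c d : Vec) :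
    (volume (convexHull ℝ ({a, b, c, d} : Set Vec))).toReal =
      volume.real stdHull * sixVol a b c d := by
  set M : Matrix (Fin 3) (Fin 3) ℝ := (Matrix.of ![b - a, c - a, d - a]).transpose with hM
  have hdet : M.det = dt (b - a) (c - a) (d - a) := by
    rw [hM, Matrix.det_transpose, Matrix.det_fin_three]; simp [dt]; ring
  have himg : convexHull ℝ ({a, b, c, d} : Set Vec) =
      (fun x => a + x) '' (Matrix.toLin' M '' stdHull) := by
    let f : Vec →ᵃ[ℝ] Vec := (Matrix.toLin' M).toAffineMap + AffineMap.const ℝ Vec a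
    have hf : ∀ x, f x = a + Matrix.toLin' M x := fun x => by simp [f, add_comm]
    have : (fun x => a + x) '' (Matrix.toLin' M '' stdHull) = f '' stdHull := by
      rw [Set.image_image]; exact Set.image_congr fun x _ => (hf x).symm
    rw [this, stdHull, AffineMap.image_convexHull]
    congr 1
    simp only [Set.image_insert_eq, Set.image_singleton]
    have v0 : f ![0, 0, 0] = a := by
      rw [hf]; ext i; fin_cases i <;> simp [hM, Matrix.mulVec, dotProduct, Fin.sum_univ_three]
    have v1 : f ![1, 0, 0] = b := by
      rw [hf]; ext i; fin_cases i <;> simp [hM, Matrix.mulVec, dotProduct, Fin.sum_univ_three]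
    have v2 : f ![0, 1, 0] = c := by
      rw [hf]; ext i; fin_cases i <;> simp [hM, Matrix.mulVec, dotProduct, Fin.sum_univ_three]
    have v3 : f ![0, 0, 1] = d := by
      rw [hf]; ext i; fin_cases i <;> simp [hM, Matrix.mulVec, dotProduct, Fin.sum_univ_three]
    rw [v0, v1, v2, v3]
  rw [himg, Set.image_add_left, measure_preimage_add, Measure.addHaar_image_linearMap,
    LinearMap.det_toLin', hdet, ENNReal.toReal_mul, ENNReal.toReal_ofReal (abs_nonneg _), mul_comm]
  rfl

theorem integral_volume_convexHull (A : Set Vec) :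
    (∫ y₁ in A, ∫ y₂ in A, ∫ y₃ in A, ∫ y₄ in A,
      (volume (convexHull ℝ ({y₁, y₂, y₃, y₄} : Set (Fin 3 → ℝ)))).toReal) =
      volume.real stdHull * totalInt A := by
  simp only [volume_convexHull_four, integral_const_mul]
  rfl

theorem volume_image_homothety {r : ℝ} (hr : 0 < r) (p : Vec) {A : Set Vec} (hA : IsCompact A) :
    volume.real ((fun x => p + r • x) '' A) = r ^ 3 * volume.real A := by
  have := setIntegral_image_homothety hr p hA fun _ => 1
  simpa using this

theorem abs_le_one_of_mem_pyr {x : Vec} (hx : x ∈ pyr) (i : Fin 3) : |x i| ≤ 1 := by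
  obtain ⟨h1, h2⟩ := hx
  have := abs_nonneg (x 0)
  have := abs_nonneg (x 1)
  fin_cases i
  · simp; linarith
  · simp; linarith
  · simp [abs_of_nonneg h2]; linarith

theorem sixVol_le_of_mem_pyr {a b c d : Vec} (ha : a ∈ pyr) (hb : b ∈ pyr) (hc : c ∈ pyr)
    (hd : d ∈ pyr) : sixVol a b c d ≤ 48 := by
  have h : ∀ x ∈ pyr, ∀ i, |(x - a) i| ≤ 2 := fun x hx i =>
    (abs_sub _ _).trans (by linarith [abs_le_one_of_mem_pyr hx i, abs_le_one_of_mem_pyr ha i])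
  have h3 : ∀ i j k, |(b - a) i * ((c - a) j * (d - a) k)| ≤ 8 := fun i j k => by
    rw [abs_mul, abs_mul]
    calc _ ≤ (2 : ℝ) * (2 * 2) := by
          gcongr <;> first | exact h _ hb _ | exact h _ hc _ | exact h _ hd _
      _ = 8 := by norm_num
  have k1 := abs_le.1 (h3 0 1 2)
  have k2 := abs_le.1 (h3 0 2 1)
  have k3 := abs_le.1 (h3 1 0 2)
  have k4 := abs_le.1 (h3 1 2 0)
  have k5 := abs_le.1 (h3 2 0 1)
  have k6 := abs_le.1 (h3 2 1 0)
  unfold sixVol dt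
  rw [abs_le]
  constructor <;> linarith

theorem pyrInt_le_of_mem_pyr {a : Vec} (ha : a ∈ pyr) : pyrInt a ≤ 48 * volume.real pyr ^ 3 := by
  have hbound (f : Vec → ℝ) (M : ℝ) (hf : Continuous f) (h : ∀ x ∈ pyr, f x ≤ M) :
      ∫ x in pyr, f x ≤ volume.real pyr * M := by
    have := setIntegral_mono_on (g := fun _ => M) (integrableOn_pyr hf)
      (integrableOn_const isCompact_pyr.measure_lt_top.ne) measurableSet_pyr h
    simpa using this
  have hk := isCompact_pyr
  refine (hbound _ (volume.real pyr * (volume.real pyr * 48)) ?_ fun b hb =>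
    hbound _ (volume.real pyr * 48) ?_ fun c hc => hbound _ 48 ?_ fun d hd =>
      sixVol_le_of_mem_pyr ha hb hc hd).trans_eq (by ring)
  · exact (continuous_vInt_mid hk hk).comp (by fun_prop : Continuous fun b : Vec => (a, b))
  · exact (continuous_vInt_inner hk).comp (by fun_prop : Continuous fun c : Vec => ((a, b), c))
  · exact .sixVol (by fun_prop) (by fun_prop) (by fun_prop) (by fun_prop)

theorem pyrInt_smul_le {x : Vec} (hx : x ∈ pyr) {δ : ℝ} (h0 : 0 ≤ δ) (h1 : δ ≤ 1) :
    pyrInt (δ • x) ≤ pyrInt 0 + δ * (48 * volume.real pyr ^ 3) := by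
  have := convexOn_pyrInt.2 (Set.mem_univ (0 : Vec)) (Set.mem_univ x) (sub_nonneg.2 h1) h0
    (by ring)
  rw [smul_zero, zero_add, smul_eq_mul, smul_eq_mul] at this
  have h2 := mul_le_mul_of_nonneg_left (pyrInt_le_of_mem_pyr hx) h0
  have h3 : 0 ≤ pyrInt 0 := vInt_nonneg _ _ _ _
  nlinarith

/-- The pyramid with a shallow pyramid of depth `1 / 10000` attached below its base. -/
def bigBody : Set Vec := {x | |x 0| + |x 1| + x 2 ≤ 1 ∧ |x 0| + |x 1| - 10000 * x 2 ≤ 1}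

/-- `bigBody` with its bottom vertex cut off. -/
def smallBody : Set Vec := bigBody ∩ {x | -(999999 / 10000000000) ≤ x 2}

/-- The bottom vertex of `bigBody`. -/
noncomputable def bottom : Vec := ![0, 0, -(1 / 10000)]

theorem bottom_apply : bottom 0 = 0 ∧ bottom 1 = 0 ∧ bottom 2 = -(1 / 10000) := ⟨rfl, rfl, rfl⟩

theorem isClosed_bigBody : IsClosed bigBody := by
  have : bigBody = {x : Vec | |x 0| + |x 1| + x 2 ≤ 1} ∩
    {x | |x 0| + |x 1| - 10000 * x 2 ≤ 1} := rfl
  rw [this]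
  exact IsClosed.inter (isClosed_le (by fun_prop) (by fun_prop))
    (isClosed_le (by fun_prop) (by fun_prop))

theorem convex_bigBody : Convex ℝ bigBody := by
  rintro x ⟨hx1, hx2⟩ y ⟨hy1, hy2⟩ s t hs ht hst
  have h (i : Fin 3) : |(s • x + t • y) i| ≤ s * |x i| + t * |y i| := by
    refine (abs_add_le _ _).trans_eq ?_
    simp [abs_mul, abs_of_nonneg hs, abs_of_nonneg ht]
  have h0 := h 0
  have h1 := h 1
  have e2 : (s • x + t • y) 2 = s * x 2 + t * y 2 := rfl
  obtain rfl : t = 1 - s := by linarith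
  constructor
  · rw [e2]; nlinarith
  · rw [e2]; nlinarith

theorem bigBody_subset : bigBody ⊆ (fun x => bottom + (10001 / 10000 : ℝ) • x) '' pyr := by
  rintro x ⟨h1, h2⟩
  obtain ⟨b0, b1, b2⟩ := bottom_apply
  refine ⟨(10000 / 10001 : ℝ) • (x - bottom), ⟨?_, ?_⟩, ?_⟩
  · simp [b0, b1, b2, abs_mul, abs_of_pos (show (0 : ℝ) < 10000 / 10001 by norm_num)]
    linarith
  · simp [b2]
    linarith [abs_nonneg (x 0), abs_nonneg (x 1)]
  · ext i; simp; ring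

theorem isCompact_bigBody : IsCompact bigBody :=
  (isCompact_pyr.image (by fun_prop)).of_isClosed_subset isClosed_bigBody bigBody_subset

theorem pyr_subset_bigBody : pyr ⊆ bigBody := by
  rintro x ⟨h1, h2⟩
  exact ⟨h1, by linarith⟩

theorem isCompact_smallBody : IsCompact smallBody :=
  isCompact_bigBody.inter_right (isClosed_le (by fun_prop) (by fun_prop))

theorem convex_smallBody : Convex ℝ smallBody := by
  refine convex_bigBody.inter ?_
  exact convex_halfSpace_ge (f := fun x : Vec => x 2) ⟨fun _ _ => rfl, fun _ _ => rfl⟩ _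

theorem smallBody_subset : smallBody ⊆ bigBody := Set.inter_subset_left

theorem pyr_subset_smallBody : pyr ⊆ smallBody := fun x hx =>
  ⟨pyr_subset_bigBody hx, le_trans (by norm_num) hx.2⟩

theorem interior_pyr_nonempty : (interior pyr).Nonempty := by
  refine ⟨![0, 0, 1 / 2], mem_interior.2
    ⟨{x : Vec | |x 0| + |x 1| + x 2 < 1} ∩ {x | 0 < x 2}, ?_, ?_, ?_⟩⟩
  · rintro x ⟨h1, h2⟩
    exact ⟨le_of_lt h1, le_of_lt h2⟩
  · exact (isOpen_lt (by fun_prop) (by fun_prop)).inter (isOpen_lt (by fun_prop) (by fun_prop))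
  · constructor <;> (simp; try norm_num)

theorem volume_diff_pos : 0 < volume.real (bigBody \ smallBody) := by
  set U : Set Vec := {x : Vec | |x 0| + |x 1| + x 2 < 1} ∩
    ({x | |x 0| + |x 1| - 10000 * x 2 < 1} ∩ {x | x 2 < -(999999 / 10000000000)}) with hU
  have hUo : IsOpen U := (isOpen_lt (by fun_prop) (by fun_prop)).inter
    ((isOpen_lt (by fun_prop) (by fun_prop)).inter (isOpen_lt (by fun_prop) (by fun_prop)))
  have hUne : U.Nonempty :=
    ⟨![0, 0, -(9999995 / 100000000000)], by simp; norm_num, by simp; norm_num, by simp; norm_num⟩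
  have hsub : U ⊆ bigBody \ smallBody := by
    rintro x ⟨h1, h2, h3⟩
    refine ⟨⟨le_of_lt h1, le_of_lt h2⟩, fun h => ?_⟩
    have h4 : -(999999 / 10000000000) ≤ x 2 := h.2
    have h5 : x 2 < -(999999 / 10000000000) := h3
    linarith
  have hfin : volume (bigBody \ smallBody) ≠ ⊤ :=
    ((measure_mono Set.sdiff_subset).trans_lt isCompact_bigBody.measure_lt_top).ne
  exact ENNReal.toReal_pos ((hUo.measure_pos volume hUne).trans_le (measure_mono hsub)).ne' hfin

theorem diff_subset : bigBody \ smallBody ⊆ (fun x => bottom + (10001 / 10000 : ℝ) • x) ''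
    ((fun x => 0 + (1 / 1000000 : ℝ) • x) '' pyr) := by
  rintro x ⟨⟨h1, h2⟩, h3⟩
  have h4 : x 2 < -(999999 / 10000000000) := not_le.1 fun h => h3 ⟨⟨h1, h2⟩, h⟩
  obtain ⟨b0, b1, b2⟩ := bottom_apply
  refine ⟨(10000 / 10001 : ℝ) • (x - bottom),
    ⟨(10000000000 / 10001 : ℝ) • (x - bottom), ⟨?_, ?_⟩, ?_⟩, ?_⟩
  · simp [b0, b1, b2, abs_mul, abs_of_pos (show (0 : ℝ) < 10000000000 / 10001 by norm_num)]
    linarith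
  · simp [b2]
    linarith [abs_nonneg (x 0), abs_nonneg (x 1)]
  · ext i; simp; ring
  · ext i; simp; ring

theorem ratio_lt_of_bounds {I J V v G : ℝ} (hV : 0 < V) (hv : 0 < v) (hvV : v < V)
    (hI : 0 ≤ I) (hIJ : I - J ≤ 4 * v * G) (h : V * V * G < I * (V - 3 / 2 * v)) :
    I / V ^ 4 < J / (V - v) ^ 4 := by
  have hd : 0 < V - v := by linarith
  rw [div_lt_div_iff₀ (by positivity) (by positivity)]
  have h1 : (V - v) ^ 4 ≤ V ^ 4 - 4 * v * V ^ 2 * (V - 3 / 2 * v) := by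
    have : V ^ 4 - 4 * v * V ^ 2 * (V - 3 / 2 * v) - (V - v) ^ 4 = v ^ 3 * (4 * V - v) := by ring
    have : 0 ≤ v ^ 3 * (4 * V - v) := mul_nonneg (by positivity) (by linarith)
    linarith
  have h2 := mul_le_mul_of_nonneg_left h1 hI
  have h3 : (I - 4 * v * G) * V ^ 4 ≤ J * V ^ 4 :=
    mul_le_mul_of_nonneg_right (by linarith) (by positivity)
  have h4 : 0 < 4 * v * V ^ 2 := by positivity
  nlinarith [mul_lt_mul_of_pos_left h h4]

theorem totalInt_ratio_lt (hup : pyrInt 0 ≤ 372 / 100 * cornerVol ^ 3)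
    (hlow : 4675 / 1000 * cornerVol ^ 3 ≤ pyrInt ![1 / 2, 1 / 6, 0]) :
    totalInt bigBody / volume.real bigBody ^ 4 <
      totalInt smallBody / volume.real smallBody ^ 4 := by
  have hκ := cornerVol_pos
  set κ := cornerVol with hκdef
  have hVP : volume.real pyr = 4 * κ := volume_pyr
  have hfin : volume bigBody ≠ ⊤ := isCompact_bigBody.measure_lt_top.ne
  have hVK1 : 4 * κ ≤ volume.real bigBody := hVP ▸ measureReal_mono pyr_subset_bigBody hfin
  have hVK2 : volume.real bigBody ≤ (10001 / 10000) ^ 3 * (4 * κ) := by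
    rw [← hVP, ← volume_image_homothety (by norm_num) bottom isCompact_pyr]
    have hQ : IsCompact ((fun x => bottom + (10001 / 10000 : ℝ) • x) '' pyr) :=
      isCompact_pyr.image (by fun_prop)
    exact measureReal_mono bigBody_subset hQ.measure_lt_top.ne
  have hv2 : volume.real (bigBody \ smallBody) ≤ 1 / 1000000 * κ := by
    have hsc : IsCompact ((fun x : Vec => 0 + (1 / 1000000 : ℝ) • x) '' pyr) :=
      isCompact_pyr.image (by fun_prop)
    have hQ := hsc.image (f := fun x => bottom + (10001 / 10000 : ℝ) • x) (by fun_prop)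
    refine (measureReal_mono diff_subset hQ.measure_lt_top.ne).trans ?_
    rw [volume_image_homothety (by norm_num) bottom hsc,
      volume_image_homothety (by norm_num) 0 isCompact_pyr, hVP]
    nlinarith
  have hVL : volume.real smallBody = volume.real bigBody - volume.real (bigBody \ smallBody) := by
    have := measureReal_sdiff (μ := volume) smallBody_subset
      isCompact_smallBody.measurableSet hfin
    linarith
  have hG : ∀ a ∈ bigBody \ smallBody, vInt bigBody bigBody bigBody a ≤
      (10001 / 10000) ^ 12 * (372 / 100 * κ ^ 3 + 1 / 1000000 * (48 * (4 * κ) ^ 3)) := by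
    intro a ha
    obtain ⟨_, ⟨x, hx, rfl⟩, rfl⟩ := diff_subset ha
    have hQ : IsCompact ((fun x => bottom + (10001 / 10000 : ℝ) • x) '' pyr) :=
      isCompact_pyr.image (by fun_prop)
    have hK := isCompact_bigBody
    refine (vInt_mono hK hK hK hQ hQ hQ bigBody_subset bigBody_subset bigBody_subset _).trans ?_
    simp only
    rw [vInt_image_homothety (by norm_num) bottom isCompact_pyr, zero_add]
    have := pyrInt_smul_le hx (δ := 1 / 1000000) (by norm_num) (by norm_num)
    rw [hVP] at this
    refine mul_le_mul_of_nonneg_left (this.trans ?_) (by norm_num)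
    linarith
  have hsub := totalInt_sub_le isCompact_bigBody isCompact_smallBody smallBody_subset hG
  have hI : 4 * κ * (374 / 100 * κ ^ 3) ≤ totalInt bigBody := by
    refine le_trans ?_ (totalInt_mono isCompact_bigBody isCompact_pyr pyr_subset_bigBody)
    have := crofton_bound
    have := mul_le_mul_of_nonneg_left hlow (show 0 ≤ 48 * κ by positivity)
    linarith
  have hI0 : 0 ≤ totalInt bigBody := le_trans (by positivity) hI
  have hv := volume_diff_pos
  rw [hVL]
  generalize volume.real bigBody = V at *
  generalize volume.real (bigBody \ smallBody) = v at *
  generalize totalInt bigBody = I at *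
  have hV : 0 < V := by linarith
  refine ratio_lt_of_bounds hV hv (by linarith) hI0 hsub ?_
  have hVv : V * (999999 / 1000000) ≤ V - 3 / 2 * v := by linarith
  refine lt_of_lt_of_le ?_ (mul_le_mul hI hVv (by positivity) hI0)
  have : V * ((10001 / 10000) ^ 12 * (372 / 100 * κ ^ 3 + 1 / 1000000 * (48 * (4 * κ) ^ 3))) <
      4 * κ * (374 / 100 * κ ^ 3) * (999999 / 1000000) := by
    refine lt_of_le_of_lt (mul_le_mul_of_nonneg_right hVK2 (by positivity)) ?_
    have h4 : 0 < κ ^ 4 := by positivity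
    norm_num
    nlinarith
  nlinarith [mul_lt_mul_of_pos_left this hV]

theorem main_of_bounds (hup : pyrInt 0 ≤ 372 / 100 * cornerVol ^ 3)
    (hlow : 4675 / 1000 * cornerVol ^ 3 ≤ pyrInt ![1 / 2, 1 / 6, 0]) :
    ∃ L K : Set (Fin 3 → ℝ),
      Convex ℝ L ∧ IsCompact L ∧ (interior L).Nonempty ∧
      Convex ℝ K ∧ IsCompact K ∧ (interior K).Nonempty ∧ L ⊆ K ∧
      (∫ y₁ in L, ∫ y₂ in L, ∫ y₃ in L, ∫ y₄ in L,
          (volume (convexHull ℝ ({y₁, y₂, y₃, y₄} : Set (Fin 3 → ℝ)))).toReal) /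
          (volume L).toReal ^ 4
        > (∫ x₁ in K, ∫ x₂ in K, ∫ x₃ in K, ∫ x₄ in K,
            (volume (convexHull ℝ ({x₁, x₂, x₃, x₄} : Set (Fin 3 → ℝ)))).toReal) /
            (volume K).toReal ^ 4 := by
  refine ⟨smallBody, bigBody, convex_smallBody, isCompact_smallBody,
    interior_pyr_nonempty.mono (interior_mono pyr_subset_smallBody), convex_bigBody,
    isCompact_bigBody, interior_pyr_nonempty.mono (interior_mono pyr_subset_bigBody),
    smallBody_subset, ?_⟩
  rw [integral_volume_convexHull, integral_volume_convexHull, mul_div_assoc, mul_div_assoc]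
  exact mul_lt_mul_of_pos_left (totalInt_ratio_lt hup hlow) volume_stdHull_pos

/-- A continuous convex function that is positively homogeneous. -/
structure IsGauge (ψ : Vec → ℝ) : Prop where
  continuous : Continuous ψ
  convexOn : ConvexOn ℝ Set.univ ψ
  smul : ∀ t : ℝ, 0 ≤ t → ∀ v, ψ (t • v) = t * ψ v

theorem IsGauge.zero {ψ : Vec → ℝ} (h : IsGauge ψ) : ψ 0 = 0 := by
  simpa using h.smul 0 le_rfl 0

theorem IsGauge.setIntegral {A : Set Vec} (hA : IsCompact A) {F : Vec → Vec → ℝ}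
    (hF : Continuous fun p : Vec × Vec => F p.1 p.2) (h : ∀ y, IsGauge fun x => F x y) :
    IsGauge fun x => ∫ y in A, F x y where
  continuous := continuous_setIntegral hA hF
  convexOn := convexOn_setIntegral hA hF fun y => (h y).convexOn
  smul t ht v := by simp only [fun y => (h y).smul t ht v, integral_const_mul]

theorem dt_swap12 (u v w : Vec) : dt v u w = -dt u v w := by unfold dt; ring

theorem dt_swap23 (u v w : Vec) : dt u w v = -dt u v w := by unfold dt; ring

theorem isGauge_abs_dt₁ (v w : Vec) : IsGauge fun u => |dt u v w| where
  continuous := by unfold dt; fun_prop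
  convexOn := by
    refine ⟨convex_univ, fun x _ y _ s t hs ht _ => ?_⟩
    have : dt (s • x + t • y) v w = s * dt x v w + t * dt y v w := by
      simp only [dt, Pi.add_apply, Pi.smul_apply, smul_eq_mul]; ring
    simp only [this, smul_eq_mul]
    refine (abs_add_le _ _).trans_eq ?_
    rw [abs_mul, abs_mul, abs_of_nonneg hs, abs_of_nonneg ht]
  smul t ht u := by
    have : dt (t • u) v w = t * dt u v w := by
      simp only [dt, Pi.smul_apply, smul_eq_mul]; ring
    rw [this, abs_mul, abs_of_nonneg ht]

theorem isGauge_abs_dt₂ (u w : Vec) : IsGauge fun v => |dt u v w| := by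
  simpa only [dt_swap12 u _ w, abs_neg] using isGauge_abs_dt₁ u w

theorem isGauge_abs_dt₃ (u v : Vec) : IsGauge fun w => |dt u v w| := by
  simpa only [dt_swap23 u _ v, abs_neg] using isGauge_abs_dt₂ u v

theorem Continuous.dt {X : Type*} [TopologicalSpace X] {a b c : X → Vec}
    (ha : Continuous a) (hb : Continuous b) (hc : Continuous c) :
    Continuous fun x => dt (a x) (b x) (c x) := by
  unfold _root_.dt; fun_prop

/-- `|dt u v w|` integrated over `w` in the translate of the pyramid by `-y`. -/
noncomputable def dtInt (y u v : Vec) : ℝ := ∫ w in pyr, |dt u v (w - y)|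

/-- `|dt u v w|` integrated over `v, w` in the translate of the pyramid by `-y`. -/
noncomputable def dtIntInt (y u : Vec) : ℝ := ∫ v in pyr, dtInt y u (v - y)

theorem pyrInt_eq (y : Vec) : pyrInt y = ∫ u in pyr, dtIntInt y (u - y) := rfl

theorem continuous_dtInt (y : Vec) : Continuous fun p : Vec × Vec => dtInt y p.1 p.2 :=
  continuous_setIntegral isCompact_pyr (F := fun (p : Vec × Vec) w => |dt p.1 p.2 (w - y)|)
    (Continuous.dt (by fun_prop) (by fun_prop) (by fun_prop)).abs

theorem isGauge_dtInt₂ (y u : Vec) : IsGauge (dtInt y u) :=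
  .setIntegral isCompact_pyr (Continuous.dt (by fun_prop) (by fun_prop) (by fun_prop)).abs
    fun _ => isGauge_abs_dt₂ _ _

theorem isGauge_dtInt₁ (y v : Vec) : IsGauge fun u => dtInt y u v :=
  .setIntegral isCompact_pyr (F := fun u w => |dt u v (w - y)|)
    (Continuous.dt (by fun_prop) (by fun_prop) (by fun_prop)).abs fun _ => isGauge_abs_dt₁ _ _

theorem isGauge_dtIntInt (y : Vec) : IsGauge (dtIntInt y) :=
  .setIntegral isCompact_pyr (F := fun u v => dtInt y u (v - y))
    ((continuous_dtInt y).comp (by fun_prop : Continuous fun p : Vec × Vec => (p.1, p.2 - y)))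
    fun _ => isGauge_dtInt₁ _ _

theorem simplexInt_translate (y a b c d : Vec) (ψ : Vec → ℝ) :
    simplexInt a b c d (fun x => ψ (x - y)) = simplexInt (a - y) (b - y) (c - y) (d - y) ψ := by
  unfold simplexInt
  congr 1; ext x; change ψ _ = ψ _; congr 1; ext i; simp [bary]; ring

theorem simplexInt_comp_linear (f : Vec →ₗ[ℝ] Vec) (a b c d : Vec) (ψ : Vec → ℝ) :
    simplexInt a b c d (fun x => ψ (f x)) = simplexInt (f a) (f b) (f c) (f d) ψ := by
  unfold simplexInt
  congr 1; ext x; simp [bary]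

theorem IsGauge.simplexInt_smul {ψ : Vec → ℝ} (h : IsGauge ψ) {t : ℝ} (ht : 0 ≤ t) (a b c : Vec) :
    simplexInt 0 (t • a) (t • b) (t • c) ψ = t * simplexInt 0 a b c ψ := by
  have := simplexInt_comp_linear (t • LinearMap.id) 0 a b c ψ
  simp only [LinearMap.smul_apply, LinearMap.id_apply, smul_zero] at this
  rw [← this]
  simp only [h.smul t ht]
  exact integral_const_mul _ _

theorem IsGauge.simplexInt_bisect {ψ : Vec → ℝ} (h : IsGauge ψ) (a b c : Vec) :
    simplexInt 0 a b c ψ = 1 / 4 * (simplexInt 0 ((2 : ℝ) • c) ((2 : ℝ) • a) (a + b) ψ +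
      simplexInt 0 ((2 : ℝ) • b) ((2 : ℝ) • c) (a + b) ψ) := by
  have e : a + b = (2 : ℝ) • ((1 / 2 : ℝ) • (a + b)) := by ext i; simp; ring
  have key := simplexInt_split a b 0 c (m := (1 / 2 : ℝ) • (a + b)) (t := 1 / 2) (by norm_num)
    (by norm_num) (fun i => by simp; ring) h.continuous
  rw [e, h.simplexInt_smul zero_le_two, h.simplexInt_smul zero_le_two]
  generalize (1 / 2 : ℝ) • (a + b) = m at *
  rw [simplexInt_swap_bc a 0 b c, simplexInt_swap_ab 0 a b c, simplexInt_swap_bc a 0 m c,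
    simplexInt_swap_ab 0 a m c, simplexInt_swap_bc m 0 b c, simplexInt_swap_ab 0 m b c] at key
  rw [key, simplexInt_swap_bc 0 a c m, simplexInt_swap_cd 0 a m c, simplexInt_swap_cd 0 b m c,
    simplexInt_swap_bc 0 m b c]
  ring

/-- Integer vectors, on which the kernel computes. -/
abbrev IVec := ℤ × ℤ × ℤ

namespace IVec

def add (p q : IVec) : IVec := (p.1 + q.1, p.2.1 + q.2.1, p.2.2 + q.2.2)

def scale (n : ℤ) (p : IVec) : IVec := (n * p.1, n * p.2.1, n * p.2.2)

def toVec (p : IVec) : Vec := ![p.1, p.2.1, p.2.2]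

theorem toVec_add (p q : IVec) : (p.add q).toVec = p.toVec + q.toVec := by
  ext i; fin_cases i <;> simp [toVec, add]

theorem toVec_scale (n : ℤ) (p : IVec) : (p.scale n).toVec = (n : ℝ) • p.toVec := by
  ext i; fin_cases i <;> simp [toVec, scale]

end IVec

/-- The sum of the values of `ψ` over a list of integer vectors. -/
def listSum (ψ : Vec → ℝ) (l : List IVec) : ℝ := (l.map fun p => ψ p.toVec).sum

@[simp] theorem listSum_nil (ψ : Vec → ℝ) : listSum ψ [] = 0 := rfl

@[simp] theorem listSum_cons (ψ : Vec → ℝ) (p : IVec) (l : List IVec) :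
    listSum ψ (p :: l) = ψ p.toVec + listSum ψ l := by simp [listSum]

theorem listSum_append (ψ : Vec → ℝ) (l₁ l₂ : List IVec) :
    listSum ψ (l₁ ++ l₂) = listSum ψ l₁ + listSum ψ l₂ := by simp [listSum]

theorem listSum_perm (ψ : Vec → ℝ) {l₁ l₂ : List IVec} (h : l₁.Perm l₂) :
    listSum ψ l₁ = listSum ψ l₂ := (h.map _).sum_eq

theorem listSum_le {ψ χ : Vec → ℝ} (h : ∀ v, ψ v ≤ χ v) (l : List IVec) :
    listSum ψ l ≤ listSum χ l := by
  induction l with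
  | nil => rfl
  | cons p l ih => simpa using add_le_add (h _) ih

theorem listSum_const_mul (t : ℝ) (ψ : Vec → ℝ) (l : List IVec) :
    listSum (fun v => t * ψ v) l = t * listSum ψ l := by
  induction l with
  | nil => simp
  | cons p l ih => simp [ih, mul_add]

theorem IsGauge.listSum_scale {ψ : Vec → ℝ} (h : IsGauge ψ) (n : ℕ) (l : List IVec) :
    listSum ψ (l.map (IVec.scale n)) = n * listSum ψ l := by
  induction l with
  | nil => simp
  | cons p l ih =>
    have := h.smul n n.cast_nonneg p.toVec
    simp [ih, IVec.toVec_scale, this, mul_add]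

/-- A list of vectors with multiplicities, expanded. -/
def expand (l : List (ℕ × IVec)) : List IVec := l.flatMap fun p => List.replicate p.1 p.2

/-- A list of vectors with multiplicities, each multiplied by its multiplicity. -/
def contract (l : List (ℕ × IVec)) : List IVec := l.map fun p => p.2.scale p.1

theorem IsGauge.listSum_expand {ψ : Vec → ℝ} (h : IsGauge ψ) (l : List (ℕ × IVec)) :
    listSum ψ (expand l) = listSum ψ (contract l) := by
  induction l with
  | nil => rfl
  | cons p l ih =>
    have h1 : expand (p :: l) = List.replicate p.1 p.2 ++ expand l := by simp [expand]
    have h2 : contract (p :: l) = p.2.scale p.1 :: contract l := rfl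
    have h3 := h.smul p.1 p.1.cast_nonneg p.2.toVec
    rw [h1, h2, listSum_append, ih, listSum_cons, IVec.toVec_scale]
    simp [listSum, h3]

/-- Repeated bisection of the triangle `a, b, c`, rescaled by `2` at every step; `f` is applied to
the triangles obtained in the end. -/
def bisect (f : IVec → IVec → IVec → List IVec) : ℕ → IVec → IVec → IVec → List IVec
  | 0, a, b, c => f a b c
  | n + 1, a, b, c => bisect f n (c.scale 2) (a.scale 2) (a.add b) ++
      bisect f n (b.scale 2) (c.scale 2) (a.add b)

def sumPoint (a b c : IVec) : List IVec := [(a.add b).add c]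

def vertices (a b c : IVec) : List IVec := [a, b, c]

theorem IsGauge.le_simplexInt {ψ : Vec → ℝ} (h : IsGauge ψ) (n : ℕ) (a b c : IVec) :
    cornerVol / (4 * 4 ^ n) * listSum ψ (bisect sumPoint n a b c) ≤
      simplexInt 0 a.toVec b.toVec c.toVec ψ := by
  induction n generalizing a b c with
  | zero =>
    have := jensen_simplexInt h.continuous h.convexOn 0 a.toVec b.toVec c.toVec
    rw [h.smul _ (by norm_num), zero_add] at this
    simp only [bisect, sumPoint, listSum_cons, listSum_nil, IVec.toVec_add]
    linarith
  | succ n ih =>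
    rw [h.simplexInt_bisect, bisect, listSum_append]
    have h1 := ih (c.scale 2) (a.scale 2) (a.add b)
    have h2 := ih (b.scale 2) (c.scale 2) (a.add b)
    simp only [IVec.toVec_scale, IVec.toVec_add, Int.cast_ofNat] at h1 h2
    refine le_trans (le_of_eq ?_) (mul_le_mul_of_nonneg_left (add_le_add h1 h2) (by norm_num))
    rw [pow_succ]; field_simp

theorem IsGauge.simplexInt_le {ψ : Vec → ℝ} (h : IsGauge ψ) (n : ℕ) (a b c : IVec) :
    simplexInt 0 a.toVec b.toVec c.toVec ψ ≤
      cornerVol / (4 * 4 ^ n) * listSum ψ (bisect vertices n a b c) := by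
  induction n generalizing a b c with
  | zero =>
    have := _root_.simplexInt_le h.continuous h.convexOn 0 a.toVec b.toVec c.toVec
    rw [h.zero, zero_add] at this
    simp only [bisect, vertices, listSum_cons, listSum_nil]
    linarith
  | succ n ih =>
    rw [h.simplexInt_bisect, bisect, listSum_append]
    have h1 := ih (c.scale 2) (a.scale 2) (a.add b)
    have h2 := ih (b.scale 2) (c.scale 2) (a.add b)
    simp only [IVec.toVec_scale, IVec.toVec_add, Int.cast_ofNat] at h1 h2
    refine (mul_le_mul_of_nonneg_left (add_le_add h1 h2) (by norm_num)).trans (le_of_eq ?_)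
    rw [pow_succ]; field_simp

/-- Vectors of natural numbers, encoding integer vectors with an offset. -/
abbrev NVec := ℕ × ℕ × ℕ

/-- The integer vector encoded by `p` with offset `K`. -/
def decode (K : ℕ) (p : NVec) : IVec := ((p.1 : ℤ) - K, (p.2.1 : ℤ) - K, (p.2.2 : ℤ) - K)

theorem toVec_decode (K : ℕ) (p : NVec) :
    (decode K p).toVec = ![(p.1 : ℝ) - K, (p.2.1 : ℝ) - K, (p.2.2 : ℝ) - K] := by
  simp [decode, IVec.toVec]

/-- The distance of two natural numbers. -/
def absDiff (a b : ℕ) : ℕ := Nat.add (Nat.sub a b) (Nat.sub b a)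

theorem cast_absDiff (a b : ℕ) : (absDiff a b : ℝ) = |(a : ℝ) - b| := by
  change (((a - b) + (b - a) : ℕ) : ℝ) = _
  rcases le_total a b with h | h
  · have h' : (a : ℝ) ≤ b := by exact_mod_cast h
    rw [Nat.sub_eq_zero_of_le h, zero_add, Nat.cast_sub h, abs_of_nonpos (by linarith), neg_sub]
  · have h' : (b : ℝ) ≤ a := by exact_mod_cast h
    rw [Nat.sub_eq_zero_of_le h, add_zero, Nat.cast_sub h, abs_of_nonneg (by linarith)]

/-- The sum of `|c₀ * x + c₁ * y + c₂ * z + e - (d * (x + y + z) + f)|` over a list of points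
`(x, y, z)`, written for fast evaluation. -/
def rowSum (c₀ c₁ c₂ d e f : ℕ) (l : List NVec) : ℕ :=
  l.foldr (fun p s => Nat.add (absDiff
    (Nat.add (Nat.mul c₀ p.1) (Nat.add (Nat.mul c₁ p.2.1) (Nat.add (Nat.mul c₂ p.2.2) e)))
    (Nat.add (Nat.mul d (Nat.add p.1 (Nat.add p.2.1 p.2.2))) f)) s) 0

/-- With `r` and the points of the list encoded with offset `K`, the sum of `|dt r p q|` over
all unordered pairs `p, q` from the list. -/
def pairSum (K : ℕ) (r : NVec) : List NVec → ℕ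
  | [] => 0
  | p :: l =>
    let P₀ := r.2.1 * p.2.2 + K * (r.2.2 + p.2.1)
    let N₀ := r.2.2 * p.2.1 + K * (r.2.1 + p.2.2)
    let P₁ := r.2.2 * p.1 + K * (r.1 + p.2.2)
    let N₁ := r.1 * p.2.2 + K * (r.2.2 + p.1)
    let P₂ := r.1 * p.2.1 + K * (r.2.1 + p.1)
    let N₂ := r.2.1 * p.1 + K * (r.1 + p.2.1)
    Nat.add (rowSum (P₀ + N₁ + N₂) (P₁ + N₀ + N₂) (P₂ + N₀ + N₁) (N₀ + N₁ + N₂)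
      (3 * K * (N₀ + N₁ + N₂)) (K * (P₀ + P₁ + P₂ + 2 * (N₀ + N₁ + N₂))) l) (pairSum K r l)

/-- With the points of the list encoded with offset `K`, the sum of `|dt r p q|` over all
unordered triples from the list. -/
def tripleSum (K : ℕ) : List NVec → ℕ
  | [] => 0
  | p :: l => Nat.add (pairSum K p l) (tripleSum K l)

theorem cast_rowSum (K : ℕ) (u v : Vec) {c₀ c₁ c₂ d e f : ℕ}
    (h₀ : (c₀ : ℝ) - d = u 1 * v 2 - u 2 * v 1) (h₁ : (c₁ : ℝ) - d = u 2 * v 0 - u 0 * v 2)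
    (h₂ : (c₂ : ℝ) - d = u 0 * v 1 - u 1 * v 0) (he : e = 3 * K * d)
    (hf : f = K * (c₀ + c₁ + c₂)) (l : List NVec) :
    (rowSum c₀ c₁ c₂ d e f l : ℝ) = listSum (fun w => |dt u v w|) (l.map (decode K)) := by
  induction l with
  | nil => simp [rowSum]
  | cons p l ih =>
    have : rowSum c₀ c₁ c₂ d e f (p :: l) = absDiff (c₀ * p.1 + (c₁ * p.2.1 + (c₂ * p.2.2 + e)))
      (d * (p.1 + (p.2.1 + p.2.2)) + f) + rowSum c₀ c₁ c₂ d e f l := rfl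
    rw [this, List.map_cons, listSum_cons, Nat.cast_add, ih, cast_absDiff, toVec_decode]
    congr 2
    have : dt u v ![(p.1 : ℝ) - K, (p.2.1 : ℝ) - K, (p.2.2 : ℝ) - K] =
        ((c₀ : ℝ) - d) * (p.1 - K) + (c₁ - d) * (p.2.1 - K) + (c₂ - d) * (p.2.2 - K) := by
      rw [h₀, h₁, h₂]; simp [dt]; ring
    rw [this, he, hf]
    push_cast
    ring

theorem listSum_add (ψ χ : Vec → ℝ) (l : List IVec) :
    listSum (fun v => ψ v + χ v) l = listSum ψ l + listSum χ l := by
  induction l with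
  | nil => simp
  | cons p l ih => simp only [listSum_cons, ih]; ring

theorem abs_dt_swap12 (u v w : Vec) : |dt v u w| = |dt u v w| := by rw [dt_swap12, abs_neg]

theorem abs_dt_swap23 (u v w : Vec) : |dt u w v| = |dt u v w| := by rw [dt_swap23, abs_neg]

theorem abs_dt_self23 (u v : Vec) : |dt u v v| = 0 := by
  rw [abs_eq_zero]; unfold dt; ring

theorem listSum_pair (u : Vec) (p : IVec) (l : List IVec) :
    listSum (fun v => listSum (fun w => |dt u v w|) (p :: l)) (p :: l) =
      2 * listSum (fun w => |dt u p.toVec w|) l +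
        listSum (fun v => listSum (fun w => |dt u v w|) l) l := by
  simp only [listSum_cons, listSum_add, abs_dt_self23, abs_dt_swap23 u p.toVec]
  ring

theorem cast_pairSum (K : ℕ) (r : NVec) (l : List NVec) :
    2 * (pairSum K r l : ℝ) = listSum (fun v => listSum (fun w => |dt (decode K r).toVec v w|)
      (l.map (decode K))) (l.map (decode K)) := by
  induction l with
  | nil => simp [pairSum]
  | cons p l ih =>
    rw [List.map_cons, listSum_pair, ← ih, pairSum]
    rw [Nat.add_eq, Nat.cast_add, cast_rowSum K (decode K r).toVec (decode K p).toVec]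
    · ring
    · simp only [toVec_decode, Matrix.cons_val]; push_cast; ring
    · simp only [toVec_decode, Matrix.cons_val]; push_cast; ring
    · simp only [toVec_decode, Matrix.cons_val]; push_cast; ring
    · rfl
    · ring

theorem cast_tripleSum (K : ℕ) (l : List NVec) :
    6 * (tripleSum K l : ℝ) = listSum (fun u => listSum (fun v => listSum (fun w => |dt u v w|)
      (l.map (decode K))) (l.map (decode K))) (l.map (decode K)) := by
  induction l with
  | nil => simp [tripleSum]
  | cons p l ih =>
    rw [List.map_cons, tripleSum, Nat.add_eq, Nat.cast_add, listSum_cons]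
    simp only [listSum_pair]
    have h0 : ∀ v, |dt (decode K p).toVec (decode K p).toVec v| = 0 := fun v => by
      rw [abs_eq_zero]; unfold dt; ring
    have h1 := cast_pairSum K p l
    simp only [listSum_add, listSum_const_mul, ← ih, h0, abs_dt_swap12 (decode K p).toVec, ← h1]
    have hz : ∀ l, listSum (fun _ => 0) l = 0 := fun l => by simp [listSum]
    rw [hz]
    ring

theorem simplexInt_star {a b c e p : Vec} {α β γ : ℝ} (hα : 0 < α) (hβ : 0 < β) (hγ : 0 < γ)
    (h : α + β + γ = 1) (hp : ∀ i, p i = α * a i + β * b i + γ * c i) {φ : Vec → ℝ}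
    (hφ : Continuous φ) : simplexInt a b c e φ =
      α * simplexInt p b c e φ + β * simplexInt a p c e φ + γ * simplexInt a b p e φ := by
  have hs : 0 < α + β := by positivity
  set t := β / (α + β) with ht
  have ht0 : 0 < t := by positivity
  have ht1 : t < 1 := by rw [ht, div_lt_one hs]; linarith
  set m : Vec := (1 - t) • a + t • b with hm
  have hmi : ∀ i, m i = (1 - t) * a i + t * b i := fun i => by simp [hm]
  have htβ : (1 - γ) * t = β := by
    rw [ht, show 1 - γ = α + β by linarith]; field_simp
  have hpi : ∀ i, p i = (1 - γ) * m i + γ * c i := fun i => by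
    rw [hp, hmi]; linear_combination (a i) * (h + htβ) - b i * htβ
  have h1 := simplexInt_split a b c e ht0 ht1 hmi hφ
  have h2 := simplexInt_split a b p e ht0 ht1 hmi hφ
  have h3 := simplexInt_split m c a e hγ (by linarith) hpi hφ
  have h4 := simplexInt_split m c b e hγ (by linarith) hpi hφ
  rw [simplexInt_swap_bc m a c e, simplexInt_swap_ab a m c e, simplexInt_swap_bc m a p e,
    simplexInt_swap_ab a m p e, simplexInt_swap_bc p a c e, simplexInt_swap_ab a p c e] at h3
  rw [simplexInt_swap_bc m b c e, simplexInt_swap_bc m b p e, simplexInt_swap_bc p b c e] at h4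
  rw [h1, h2, h3, h4]
  linear_combination (simplexInt a p c e φ - simplexInt p b c e φ) * htβ +
    simplexInt p b c e φ * (-h)

theorem simplexInt_cross {a b p q e k : Vec} {s t : ℝ} (hs : 0 < s) (hs1 : s < 1) (ht : 0 < t)
    (ht1 : t < 1) (hk : ∀ i, k i = (1 - s) * a i + s * b i)
    (hk' : ∀ i, k i = (1 - t) * p i + t * q i) {φ : Vec → ℝ} (hφ : Continuous φ) :
    t * simplexInt a b p e φ + (1 - t) * simplexInt a b q e φ =
      s * simplexInt p q a e φ + (1 - s) * simplexInt p q b e φ := by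
  rw [simplexInt_split a b p e hs hs1 hk hφ, simplexInt_split a b q e hs hs1 hk hφ,
    simplexInt_split p q a e ht ht1 hk' hφ, simplexInt_split p q b e ht ht1 hk' hφ,
    simplexInt_swap_bc p a k e, simplexInt_swap_ab a p k e, simplexInt_swap_bc a k p e,
    simplexInt_swap_bc k a q e, simplexInt_swap_ab a k q e, simplexInt_swap_bc p b k e,
    simplexInt_swap_ab b p k e, simplexInt_swap_bc b k p e, simplexInt_swap_ab k b p e,
    simplexInt_swap_bc k b q e]
  ring

theorem corner_integral_flip {s₀ s₁ : ℝ} (φ : Vec → ℝ) :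
    ∫ x in corner, φ ![s₀ * x 0, s₁ * x 1, x 2] =
      simplexInt 0 ![s₀, 0, 0] ![0, s₁, 0] ![0, 0, 1] φ := by
  unfold simplexInt
  congr 1; ext x; congr 1; ext i; fin_cases i <;> simp [bary, mul_comm]

theorem pyr_integral_eq_simplexInt {φ : Vec → ℝ} (hφ : Continuous φ) :
    ∫ x in pyr, φ x = simplexInt 0 ![1, 0, 0] ![0, 1, 0] ![0, 0, 1] φ +
      simplexInt 0 ![-1, 0, 0] ![0, 1, 0] ![0, 0, 1] φ +
      simplexInt 0 ![1, 0, 0] ![0, -1, 0] ![0, 0, 1] φ +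
      simplexInt 0 ![-1, 0, 0] ![0, -1, 0] ![0, 0, 1] φ := by
  rw [pyr_integral hφ]
  simp only [← corner_integral_flip, one_mul, neg_one_mul]

theorem pyr_integral_eq_star {φ : Vec → ℝ} (hφ : Continuous φ) :
    ∫ x in pyr, φ x =
      1 / 3 * simplexInt ![1 / 2, 1 / 6, 0] ![1, 0, 0] ![0, 1, 0] ![0, 0, 1] φ +
      4 / 3 * simplexInt ![1 / 2, 1 / 6, 0] ![-1, 0, 0] ![0, 1, 0] ![0, 0, 1] φ +
      5 / 3 * simplexInt ![1 / 2, 1 / 6, 0] ![-1, 0, 0] ![0, -1, 0] ![0, 0, 1] φ +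
      2 / 3 * simplexInt ![1 / 2, 1 / 6, 0] ![0, -1, 0] ![1, 0, 0] ![0, 0, 1] φ := by
  have h1 := simplexInt_star (a := 0) (b := ![1, 0, 0]) (c := ![0, 1, 0]) (e := ![0, 0, 1])
    (p := ![1 / 2, 1 / 6, 0]) (α := 1 / 3) (β := 1 / 2) (γ := 1 / 6) (by norm_num) (by norm_num)
    (by norm_num) (by norm_num) (fun i => by fin_cases i <;> simp) hφ
  have h2 := simplexInt_cross (a := 0) (b := ![1, 0, 0]) (p := ![1 / 2, 1 / 6, 0])
    (q := ![0, -1, 0]) (e := ![0, 0, 1]) (k := ![3 / 7, 0, 0]) (s := 3 / 7) (t := 1 / 7)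
    (by norm_num) (by norm_num) (by norm_num) (by norm_num)
    (fun i => by fin_cases i <;> simp) (fun i => by fin_cases i <;> simp <;> norm_num) hφ
  have h3 := simplexInt_cross (a := 0) (b := ![0, 1, 0]) (p := ![1 / 2, 1 / 6, 0])
    (q := ![-1, 0, 0]) (e := ![0, 0, 1]) (k := ![0, 1 / 9, 0]) (s := 1 / 9) (t := 1 / 3)
    (by norm_num) (by norm_num) (by norm_num) (by norm_num)
    (fun i => by fin_cases i <;> simp) (fun i => by fin_cases i <;> simp <;> norm_num) hφ
  have h4 := simplexInt_star (a := ![1 / 2, 1 / 6, 0]) (b := ![-1, 0, 0]) (c := ![0, -1, 0])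
    (e := ![0, 0, 1]) (p := 0) (α := 3 / 5) (β := 3 / 10) (γ := 1 / 10) (by norm_num)
    (by norm_num) (by norm_num) (by norm_num)
    (fun i => by fin_cases i <;> simp <;> norm_num) hφ
  rw [pyr_integral_eq_simplexInt hφ]
  generalize (![1 / 2, 1 / 6, 0] : Vec) = y at *
  rw [simplexInt_swap_bc 0 ![0, 1, 0] y] at h1
  rw [simplexInt_swap_bc 0 ![-1, 0, 0] ![0, 1, 0]] at h3
  rw [simplexInt_swap_bc y ![0, -1, 0] 0] at h4
  linarith

/-- The points at which the lower bound evaluates the integrand, with weights included: sums of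
vertices of bisected faces of the pyramid, relative to `(1 / 2, 1 / 6, 0)` and scaled by `6`. -/
def lowPoints : List IVec :=
  (bisect sumPoint 3 (3, -1, 0) (-3, 5, 0) (-3, -1, 6)).map (IVec.scale 16) ++
  (bisect sumPoint 4 (-3, -1, 6) (-9, -1, 0) (-3, 5, 0)).map (IVec.scale 16) ++
  (bisect sumPoint 5 (-3, -1, 6) (-9, -1, 0) (-3, -7, 0)).map (IVec.scale 5) ++
  (bisect sumPoint 3 (-3, -1, 6) (-3, -7, 0) (3, -1, 0)).map (IVec.scale 32)

theorem simplexInt_rotate_last (a b c d : Vec) (φ : Vec → ℝ) :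
    simplexInt a d b c φ = simplexInt a b c d φ := by
  rw [simplexInt_swap_bc a b d c, simplexInt_swap_cd]

theorem IsGauge.simplexInt_six {ψ : Vec → ℝ} (h : IsGauge ψ) {y a b c : Vec} {a' b' c' : IVec}
    (ha : a'.toVec = (6 : ℝ) • (a - y)) (hb : b'.toVec = (6 : ℝ) • (b - y))
    (hc : c'.toVec = (6 : ℝ) • (c - y)) :
    simplexInt y a b c (fun x => ψ (x - y)) =
      1 / 6 * simplexInt 0 a'.toVec b'.toVec c'.toVec ψ := by
  rw [ha, hb, hc, h.simplexInt_smul (by norm_num), simplexInt_translate, sub_self]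
  ring

theorem IsGauge.le_pyr_integral {ψ : Vec → ℝ} (h : IsGauge ψ) :
    cornerVol / 73728 * listSum ψ lowPoints ≤ ∫ x in pyr, ψ (x - ![1 / 2, 1 / 6, 0]) := by
  have hcast : Continuous fun x : Vec => ψ (x - ![1 / 2, 1 / 6, 0]) :=
    h.continuous.comp (by fun_prop)
  have e1 : IVec.toVec (3, -1, 0) = (6 : ℝ) • ((![1, 0, 0] : Vec) - ![1 / 2, 1 / 6, 0]) := by
    ext i; fin_cases i <;> simp [IVec.toVec] <;> norm_num
  have e2 : IVec.toVec (-3, 5, 0) = (6 : ℝ) • ((![0, 1, 0] : Vec) - ![1 / 2, 1 / 6, 0]) := by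
    ext i; fin_cases i <;> simp [IVec.toVec] <;> norm_num
  have e3 : IVec.toVec (-9, -1, 0) = (6 : ℝ) • ((![-1, 0, 0] : Vec) - ![1 / 2, 1 / 6, 0]) := by
    ext i; fin_cases i <;> simp [IVec.toVec] <;> norm_num
  have e4 : IVec.toVec (-3, -7, 0) = (6 : ℝ) • ((![0, -1, 0] : Vec) - ![1 / 2, 1 / 6, 0]) := by
    ext i; fin_cases i <;> simp [IVec.toVec] <;> norm_num
  have e5 : IVec.toVec (-3, -1, 6) = (6 : ℝ) • ((![0, 0, 1] : Vec) - ![1 / 2, 1 / 6, 0]) := by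
    ext i; fin_cases i <;> simp [IVec.toVec] <;> norm_num
  rw [pyr_integral_eq_star hcast, h.simplexInt_six e1 e2 e5,
    ← simplexInt_rotate_last _ ![-1, 0, 0] ![0, 1, 0], h.simplexInt_six e5 e3 e2,
    ← simplexInt_rotate_last _ ![-1, 0, 0] ![0, -1, 0], h.simplexInt_six e5 e3 e4,
    ← simplexInt_rotate_last _ ![0, -1, 0] ![1, 0, 0], h.simplexInt_six e5 e4 e1]
  have b1 := h.le_simplexInt 3 (3, -1, 0) (-3, 5, 0) (-3, -1, 6)
  have b2 := h.le_simplexInt 4 (-3, -1, 6) (-9, -1, 0) (-3, 5, 0)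
  have b3 := h.le_simplexInt 5 (-3, -1, 6) (-9, -1, 0) (-3, -7, 0)
  have b4 := h.le_simplexInt 3 (-3, -1, 6) (-3, -7, 0) (3, -1, 0)
  have s16 := h.listSum_scale 16
  have s5 := h.listSum_scale 5
  have s32 := h.listSum_scale 32
  push_cast at s16 s5 s32
  simp only [lowPoints, listSum_append, s16, s5, s32]
  linarith

/-- The points of `lowPoints` divided by `24`, encoded with offset `256`. -/
def lowCode : List NVec := [
  (248, 264, 288), (232, 248, 320), (280, 248, 272), (264, 264, 272), (232, 296, 272),
  (216, 312, 272), (216, 264, 320), (232, 280, 288), (128, 304, 336), (96, 272, 336),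
  (144, 368, 288), (144, 336, 320), (144, 272, 384), (144, 240, 416), (96, 240, 368),
  (128, 272, 368), (48, 272, 288), (48, 240, 320), (0, 240, 272), (32, 272, 272), (96, 336, 272),
  (128, 368, 272), (80, 272, 320), (80, 304, 288), (171, 186, 301), (181, 186, 311),
  (151, 216, 311), (161, 196, 301), (181, 156, 281), (191, 136, 271), (191, 166, 301),
  (181, 166, 291), (181, 216, 341), (191, 196, 331), (191, 226, 361), (181, 226, 351),
  (161, 226, 331), (151, 226, 321), (181, 196, 321), (171, 216, 331), (121, 216, 281),
  (131, 196, 271), (131, 226, 301), (121, 226, 291), (101, 226, 271), (91, 226, 261),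
  (121, 196, 261), (111, 216, 271), (161, 166, 271), (151, 166, 261), (181, 136, 261),
  (171, 156, 271), (151, 196, 291), (141, 216, 301), (141, 186, 271), (151, 186, 281),
  (224, 176, 336), (288, 208, 304), (192, 208, 400), (192, 176, 368), (192, 112, 304),
  (192, 80, 272), (288, 176, 272), (224, 144, 304)]

theorem lowPoints_eq : lowPoints = (lowCode.map (decode 256)).map (IVec.scale 24) := by
  decide +kernel

theorem le_tripleSum_lowCode : 22589000000 ≤ tripleSum 256 lowCode := by
  decide +kernel

theorem IsGauge.le_pyr_integral_lowCode {ψ : Vec → ℝ} (h : IsGauge ψ) :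
    cornerVol / 3072 * listSum ψ (lowCode.map (decode 256)) ≤
      ∫ x in pyr, ψ (x - ![1 / 2, 1 / 6, 0]) := by
  refine le_trans (le_of_eq ?_) h.le_pyr_integral
  have := h.listSum_scale 24 (lowCode.map (decode 256))
  push_cast at this
  rw [lowPoints_eq, this]
  ring

theorem le_pyrInt : 4675 / 1000 * cornerVol ^ 3 ≤ pyrInt ![1 / 2, 1 / 6, 0] := by
  have hκ := cornerVol_pos
  set y : Vec := ![1 / 2, 1 / 6, 0] with hy
  set c := cornerVol / 3072 with hc
  have hc0 : 0 ≤ c := by positivity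
  have h1 (u : Vec) : c * (c * listSum (fun v => listSum (fun w => |dt u v w|)
      (lowCode.map (decode 256))) (lowCode.map (decode 256))) ≤ dtIntInt y u := by
    refine le_trans ?_ (isGauge_dtInt₂ y u).le_pyr_integral_lowCode
    rw [← listSum_const_mul]
    exact mul_le_mul_of_nonneg_left (listSum_le (fun v =>
      (isGauge_abs_dt₃ u v).le_pyr_integral_lowCode) _) hc0
  have h2 := (isGauge_dtIntInt y).le_pyr_integral_lowCode
  have h3 := mul_le_mul_of_nonneg_left (listSum_le h1 (lowCode.map (decode 256))) hc0
  simp only [listSum_const_mul, ← cast_tripleSum] at h3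
  refine le_trans ?_ (h3.trans h2)
  have h4 : (22589000000 : ℝ) ≤ tripleSum 256 lowCode := by exact_mod_cast le_tripleSum_lowCode
  rw [hc]
  have : 0 < cornerVol ^ 3 := by positivity
  nlinarith

theorem pyr_integral_swap02 {φ : Vec → ℝ} (hc : Continuous φ) (he : ∀ x, φ (-x) = φ x) :
    ∫ x in pyr, φ ![x 2, x 1, x 0] = ∫ x in pyr, φ x := by
  have hswap (f : Vec → ℝ) : ∫ x in corner, f ![x 2, x 1, x 0] = ∫ x in corner, f x := by
    rw [← corner_integral_swap01 f, ← corner_integral_swap12 fun x => f ![x 1, x 0, x 2],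
      ← corner_integral_swap01]
    simp
  have h1 (x : Vec) : φ ![x 2, x 1, -x 0] = φ ![-x 2, -x 1, x 0] := by rw [← he]; simp
  have h2 (x : Vec) : φ ![x 2, -x 1, -x 0] = φ ![-x 2, x 1, x 0] := by rw [← he]; simp
  have hc' : Continuous fun x : Vec => φ ![x 2, x 1, x 0] := hc.comp (by fun_prop)
  rw [pyr_integral hc, pyr_integral hc',
    ← hswap fun x => φ ![x 0, x 1, x 2], ← hswap fun x => φ ![-x 0, x 1, x 2],
    ← hswap fun x => φ ![x 0, -x 1, x 2], ← hswap fun x => φ ![-x 0, -x 1, x 2]]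
  simp [h1, h2]
  ring

theorem dtIntInt_comp {f : Vec → Vec} (hf : ∀ φ : Vec → ℝ, Continuous φ → (∀ x, φ (-x) = φ x) →
    ∫ x in pyr, φ (f x) = ∫ x in pyr, φ x)
    (hdt : ∀ u v w, |dt (f u) (f v) (f w)| = |dt u v w|) (u : Vec) :
    dtIntInt 0 (f u) = dtIntInt 0 u := by
  have hneg₃ (u v w : Vec) : |dt u v (-w)| = |dt u v w| := by
    rw [show dt u v (-w) = -dt u v w by simp [dt]; ring, abs_neg]
  have hneg₂ (u v w : Vec) : |dt u (-v) w| = |dt u v w| := by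
    rw [show dt u (-v) w = -dt u v w by simp [dt]; ring, abs_neg]
  unfold dtIntInt
  simp only [sub_zero]
  rw [← hf _ (isGauge_dtInt₂ 0 (f u)).continuous fun v => by simp only [dtInt, hneg₂]]
  congr 1; ext v
  simp only [dtInt, sub_zero]
  rw [← hf _ (isGauge_abs_dt₃ (f u) (f v)).continuous fun w => hneg₃ _ _ _]
  simp only [hdt]

theorem dtIntInt_flip0 (u : Vec) : dtIntInt 0 ![-u 0, u 1, u 2] = dtIntInt 0 u :=
  dtIntInt_comp (f := fun u => ![-u 0, u 1, u 2]) (fun φ _ _ => pyr_integral_flip0 φ)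
    (fun u v w => by rw [← abs_neg]; congr 1; simp [dt]; ring) u

theorem dtIntInt_flip1 (u : Vec) : dtIntInt 0 ![u 0, -u 1, u 2] = dtIntInt 0 u :=
  dtIntInt_comp (f := fun u => ![u 0, -u 1, u 2]) (fun φ _ _ => pyr_integral_flip1 φ)
    (fun u v w => by rw [← abs_neg]; congr 1; simp [dt]; ring) u

theorem dtIntInt_swap01 (u : Vec) : dtIntInt 0 ![u 1, u 0, u 2] = dtIntInt 0 u :=
  dtIntInt_comp (f := fun u => ![u 1, u 0, u 2]) (fun φ _ _ => pyr_integral_swap01 φ)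
    (fun u v w => by rw [← abs_neg]; congr 1; simp [dt]; ring) u

theorem dtIntInt_swap02 (u : Vec) : dtIntInt 0 ![u 2, u 1, u 0] = dtIntInt 0 u :=
  dtIntInt_comp (f := fun u => ![u 2, u 1, u 0]) (fun _ hc he => pyr_integral_swap02 hc he)
    (fun u v w => by rw [← abs_neg]; congr 1; simp [dt]; ring) u

theorem dtIntInt_swap12 (u : Vec) : dtIntInt 0 ![u 0, u 2, u 1] = dtIntInt 0 u := by
  have h1 := dtIntInt_swap01 ![u 0, u 2, u 1]
  have h2 := dtIntInt_swap02 ![u 1, u 0, u 2]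
  have h3 := dtIntInt_swap01 u
  simp only [Matrix.cons_val] at h1 h2
  rw [← h1, h2, h3]

namespace IVec

def flip0 (p : IVec) : IVec := (-p.1, p.2.1, p.2.2)

def flip1 (p : IVec) : IVec := (p.1, -p.2.1, p.2.2)

/-- Exchange the first two coordinates if they are out of order. -/
def order01 (p : IVec) : IVec := if p.2.1 < p.1 then (p.2.1, p.1, p.2.2) else p

/-- Exchange the last two coordinates if they are out of order. -/
def order12 (p : IVec) : IVec := if p.2.2 < p.2.1 then (p.1, p.2.2, p.2.1) else p

/-- Sort the coordinates. -/
def sort (p : IVec) : IVec := p.order01.order12.order01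

/-- The images of `p` under sign changes of the first two coordinates. -/
def signs (p : IVec) : List IVec := [p, p.flip0, p.flip1, p.flip0.flip1]

/-- The list `signs p` with vectors that agree up to sign replaced by their sum. -/
def mergedSigns (p : IVec) : List IVec :=
  if p.1 = 0 then
    if p.2.1 = 0 ∨ p.2.2 = 0 then [p.scale 4] else [p.scale 2, p.flip1.scale 2]
  else if p.2.1 = 0 then
    if p.2.2 = 0 then [p.scale 4] else [p.scale 2, p.flip0.scale 2]
  else if p.2.2 = 0 then [p.scale 2, p.flip0.scale 2] else p.signs

theorem dtIntInt_sort (p : IVec) : dtIntInt 0 p.sort.toVec = dtIntInt 0 p.toVec := by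
  have h1 (q : IVec) : dtIntInt 0 q.order01.toVec = dtIntInt 0 q.toVec := by
    unfold order01
    split_ifs
    · exact dtIntInt_swap01 q.toVec
    · rfl
  have h2 (q : IVec) : dtIntInt 0 q.order12.toVec = dtIntInt 0 q.toVec := by
    unfold order12
    split_ifs
    · exact dtIntInt_swap12 q.toVec
    · rfl
  rw [sort, h1, h2, h1]

end IVec

theorem IsGauge.listSum_mergedSigns {ψ : Vec → ℝ} (h : IsGauge ψ) (he : ∀ v, ψ (-v) = ψ v)
    (p : IVec) : listSum ψ p.mergedSigns = listSum ψ p.signs := by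
  have h2 (q : IVec) : ψ (q.scale 2).toVec = 2 * ψ q.toVec := by
    rw [IVec.toVec_scale]; exact_mod_cast h.smul 2 (by norm_num) _
  have h4 (q : IVec) : ψ (q.scale 4).toVec = 4 * ψ q.toVec := by
    rw [IVec.toVec_scale]; exact_mod_cast h.smul 4 (by norm_num) _
  have hneg (q : IVec) : ψ (IVec.toVec (-q.1, -q.2.1, -q.2.2)) = ψ q.toVec := by
    rw [← he]; simp [IVec.toVec]
  obtain ⟨x, y, z⟩ := p
  have k1 := hneg (x, y, z)
  have k2 := hneg (-x, y, z)
  simp only [neg_neg] at k1 k2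
  unfold IVec.mergedSigns
  split_ifs with hx hyz hy hz hz <;> simp only at *
  · subst hx
    rcases hyz with rfl | rfl <;>
      simp_all [IVec.signs, IVec.flip0, IVec.flip1] <;> ring
  · subst hx
    simp_all [IVec.signs, IVec.flip0, IVec.flip1]; ring
  · subst hy hz
    simp_all [IVec.signs, IVec.flip0, IVec.flip1]; ring
  · subst hy
    simp_all [IVec.signs, IVec.flip0, IVec.flip1]; ring
  · subst hz
    simp_all [IVec.signs, IVec.flip0, IVec.flip1]; ring

theorem listSum_flatMap_signs (ψ : Vec → ℝ) (l : List IVec) :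
    listSum ψ (l.flatMap IVec.signs) = listSum ψ l + listSum ψ (l.map IVec.flip0) +
      listSum ψ (l.map IVec.flip1) + listSum ψ (l.map fun p => p.flip0.flip1) := by
  induction l with
  | nil => simp
  | cons p l ih =>
    rw [List.flatMap_cons, listSum_append, ih]
    simp only [IVec.signs, List.map_cons, listSum_cons, listSum_nil]
    ring

theorem IsGauge.listSum_expand_signs {ψ : Vec → ℝ} (h : IsGauge ψ) (he : ∀ v, ψ (-v) = ψ v)
    (l : List (ℕ × IVec)) : listSum ψ ((expand l).flatMap IVec.signs) =
      listSum ψ ((contract l).flatMap IVec.mergedSigns) := by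
  induction l with
  | nil => rfl
  | cons p l ih =>
    have h1 : expand (p :: l) = List.replicate p.1 p.2 ++ expand l := by simp [expand]
    have h2 : contract (p :: l) = p.2.scale p.1 :: contract l := rfl
    have h3 (q : IVec) : ψ (q.scale p.1).toVec = p.1 * ψ q.toVec := by
      rw [IVec.toVec_scale]; exact_mod_cast h.smul p.1 p.1.cast_nonneg _
    have h4 : (p.2.scale p.1).signs = p.2.signs.map (IVec.scale p.1) := by
      simp [IVec.signs, IVec.flip0, IVec.flip1, IVec.scale]
    rw [h1, h2, List.flatMap_append, listSum_append, ih, List.flatMap_cons, listSum_append,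
      h.listSum_mergedSigns he, h4, listSum_flatMap_signs]
    simp [IVec.signs, h3, listSum]
    ring

theorem bisect_vertices_map {f : IVec → IVec} (hadd : ∀ p q, f (p.add q) = (f p).add (f q))
    (hscale : ∀ p, f (p.scale 2) = (f p).scale 2) (n : ℕ) (a b c : IVec) :
    bisect vertices n (f a) (f b) (f c) = (bisect vertices n a b c).map f := by
  induction n generalizing a b c with
  | zero => rfl
  | succ n ih => simp only [bisect, ← hadd, ← hscale, ih, List.map_append]

/-- The vertices, with repetition, of the triangles in the sixth bisection of a face. -/
def upPoints : List IVec := bisect vertices 6 (1, 0, 0) (0, 1, 0) (0, 0, 1)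

/-- The points of `upPoints` with their multiplicities. -/
def upMult : List (ℕ × IVec) := [
  (8, 24, 8, 32), (8, 32, 16, 16), (4, 24, 16, 24), (8, 16, 16, 32), (4, 32, 0, 32),
  (4, 32, 8, 24), (8, 24, 24, 16), (4, 32, 24, 8), (4, 32, 32, 0), (8, 8, 8, 48), (4, 16, 0, 48),
  (4, 16, 8, 40), (2, 0, 0, 64), (2, 8, 0, 56), (2, 24, 0, 40), (8, 40, 8, 16), (4, 48, 0, 16),
  (4, 48, 8, 8), (4, 48, 16, 0), (2, 40, 0, 24), (4, 56, 8, 0), (2, 56, 0, 8), (1, 64, 0, 0),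
  (4, 40, 24, 0), (4, 40, 16, 8), (8, 8, 40, 16), (8, 16, 32, 16), (4, 16, 40, 8), (4, 16, 48, 0),
  (4, 0, 32, 32), (4, 8, 32, 24), (4, 24, 40, 0), (4, 24, 32, 8), (4, 8, 56, 0), (4, 0, 48, 16),
  (4, 8, 48, 8), (1, 0, 64, 0), (2, 0, 56, 8), (2, 0, 40, 24), (8, 8, 24, 32), (4, 0, 16, 48),
  (4, 8, 16, 40), (2, 0, 24, 40), (2, 0, 8, 56), (4, 16, 24, 24)]

/-- The points of `upPoints` with sorted coordinates and their multiplicities. -/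
def upOrbits : List (ℕ × IVec) := [
  (4, 0, 0, 64), (16, 0, 8, 56), (24, 0, 16, 48), (16, 0, 24, 40), (12, 0, 32, 32), (16, 8, 8, 48),
  (32, 8, 16, 40), (32, 8, 24, 32), (24, 16, 16, 32), (16, 16, 24, 24)]

/-- The points of `upPoints` and their reflections with multiplicities included, divided by `32`
and encoded with offset `16`. -/
def upCode : List NVec := [
  (22, 18, 24), (10, 18, 24), (22, 14, 24), (10, 14, 24), (24, 20, 20), (8, 20, 20), (24, 12, 20),
  (8, 12, 20), (19, 18, 19), (13, 18, 19), (19, 14, 19), (13, 14, 19), (20, 20, 24), (12, 20, 24),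
  (20, 12, 24), (12, 12, 24), (24, 16, 24), (8, 16, 24), (20, 17, 19), (12, 17, 19), (20, 15, 19),
  (12, 15, 19), (22, 22, 20), (10, 22, 20), (22, 10, 20), (10, 10, 20), (20, 19, 17), (12, 19, 17),
  (20, 13, 17), (12, 13, 17), (24, 24, 16), (8, 24, 16), (18, 18, 28), (14, 18, 28), (18, 14, 28),
  (14, 14, 28), (20, 16, 28), (12, 16, 28), (18, 17, 21), (14, 17, 21), (18, 15, 21), (14, 15, 21),
  (16, 16, 32), (17, 16, 23), (15, 16, 23), (19, 16, 21), (13, 16, 21), (26, 18, 20), (6, 18, 20),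
  (26, 14, 20), (6, 14, 20), (28, 16, 20), (4, 16, 20), (22, 17, 17), (10, 17, 17), (22, 15, 17),
  (10, 15, 17), (28, 20, 16), (4, 20, 16), (21, 16, 19), (11, 16, 19), (30, 18, 16), (2, 18, 16),
  (23, 16, 17), (9, 16, 17), (24, 16, 16), (26, 22, 16), (6, 22, 16), (21, 18, 17), (11, 18, 17),
  (21, 14, 17), (11, 14, 17), (18, 26, 20), (14, 26, 20), (18, 6, 20), (14, 6, 20), (20, 24, 20),
  (12, 24, 20), (20, 8, 20), (12, 8, 20), (18, 21, 17), (14, 21, 17), (18, 11, 17), (14, 11, 17),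
  (20, 28, 16), (12, 28, 16), (16, 24, 24), (16, 8, 24), (17, 20, 19), (15, 20, 19), (17, 12, 19),
  (15, 12, 19), (22, 26, 16), (10, 26, 16), (19, 20, 17), (13, 20, 17), (19, 12, 17), (13, 12, 17),
  (18, 30, 16), (14, 30, 16), (16, 28, 20), (16, 4, 20), (17, 22, 17), (15, 22, 17), (17, 10, 17),
  (15, 10, 17), (16, 24, 16), (16, 23, 17), (16, 9, 17), (16, 21, 19), (16, 11, 19), (18, 22, 24),
  (14, 22, 24), (18, 10, 24), (14, 10, 24), (16, 20, 28), (16, 12, 28), (17, 18, 21), (15, 18, 21),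
  (17, 14, 21), (15, 14, 21), (16, 19, 21), (16, 13, 21), (16, 17, 23), (16, 15, 23), (18, 19, 19),
  (14, 19, 19), (18, 13, 19), (14, 13, 19)]

/-- The points of `upOrbits` with multiplicities included, divided by `128` and encoded with
offset `16`. -/
def orbitCode : List NVec := [
  (16, 16, 18), (16, 17, 23), (16, 19, 25), (16, 19, 21), (16, 19, 19), (17, 17, 22), (18, 20, 26),
  (18, 22, 24), (19, 19, 22), (18, 19, 19)]

theorem upPoints_perm : upPoints.Perm (expand upMult) := by decide +kernel

theorem upPoints_sort_perm : (upPoints.map IVec.sort).Perm (expand upOrbits) := by decide +kernel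

theorem upMult_eq : (contract upMult).flatMap IVec.mergedSigns =
    (upCode.map (decode 16)).map (IVec.scale 32) := by decide +kernel

theorem upOrbits_eq : contract upOrbits = (orbitCode.map (decode 16)).map (IVec.scale 128) := by
  decide +kernel

theorem sum_pairSum_le : (orbitCode.map fun r => pairSum 16 r upCode).sum ≤ 15600000 := by
  decide +kernel

theorem IsGauge.pyr_integral_le {ψ : Vec → ℝ} (h : IsGauge ψ) (he : ∀ v, ψ (-v) = ψ v) :
    ∫ x in pyr, ψ x ≤ cornerVol / 512 * listSum ψ (upCode.map (decode 16)) := by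
  have e1 : IVec.toVec (1, 0, 0) = ![1, 0, 0] := by simp [IVec.toVec]
  have e2 : IVec.toVec (0, 1, 0) = ![0, 1, 0] := by simp [IVec.toVec]
  have e3 : IVec.toVec (0, 0, 1) = ![0, 0, 1] := by simp [IVec.toVec]
  have e4 : IVec.toVec (-1, 0, 0) = ![-1, 0, 0] := by simp [IVec.toVec]
  have e5 : IVec.toVec (0, -1, 0) = ![0, -1, 0] := by simp [IVec.toVec]
  have b1 := h.simplexInt_le 6 (1, 0, 0) (0, 1, 0) (0, 0, 1)
  have b2 := h.simplexInt_le 6 (-1, 0, 0) (0, 1, 0) (0, 0, 1)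
  have b3 := h.simplexInt_le 6 (1, 0, 0) (0, -1, 0) (0, 0, 1)
  have b4 := h.simplexInt_le 6 (-1, 0, 0) (0, -1, 0) (0, 0, 1)
  have m2 : bisect vertices 6 (-1, 0, 0) (0, 1, 0) (0, 0, 1) = upPoints.map IVec.flip0 :=
    bisect_vertices_map (f := IVec.flip0) (fun p q => by simp [IVec.flip0, IVec.add]; ring)
      (fun p => by simp [IVec.flip0, IVec.scale]) 6 (1, 0, 0) (0, 1, 0) (0, 0, 1)
  have m3 : bisect vertices 6 (1, 0, 0) (0, -1, 0) (0, 0, 1) = upPoints.map IVec.flip1 :=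
    bisect_vertices_map (f := IVec.flip1) (fun p q => by simp [IVec.flip1, IVec.add]; ring)
      (fun p => by simp [IVec.flip1, IVec.scale]) 6 (1, 0, 0) (0, 1, 0) (0, 0, 1)
  have m4 : bisect vertices 6 (-1, 0, 0) (0, -1, 0) (0, 0, 1) =
      upPoints.map fun p => p.flip0.flip1 :=
    bisect_vertices_map (f := fun p => p.flip0.flip1)
      (fun p q => by simp [IVec.flip0, IVec.flip1, IVec.add]; constructor <;> ring)
      (fun p => by simp [IVec.flip0, IVec.flip1, IVec.scale]) 6 (1, 0, 0) (0, 1, 0) (0, 0, 1)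
  rw [e1, e2, e3] at b1
  rw [e4, e2, e3, m2] at b2
  rw [e1, e5, e3, m3] at b3
  rw [e4, e5, e3, m4] at b4
  have hsum := listSum_flatMap_signs ψ upPoints
  rw [listSum_perm ψ (upPoints_perm.flatMap_right _), h.listSum_expand_signs he, upMult_eq,
    show (32 : ℤ) = ((32 : ℕ) : ℤ) from rfl, h.listSum_scale] at hsum
  rw [pyr_integral_eq_simplexInt h.continuous]
  have : bisect vertices 6 (1, 0, 0) (0, 1, 0) (0, 0, 1) = upPoints := rfl
  rw [this] at b1
  push_cast at hsum
  have key := mul_le_mul_of_nonneg_left hsum.symm.le (show 0 ≤ cornerVol / 16384 from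
    div_nonneg cornerVol_pos.le (by norm_num))
  norm_num at b1 b2 b3 b4
  linarith

theorem pyr_integral_dtIntInt_le :
    ∫ u in pyr, dtIntInt 0 u ≤
      cornerVol / 32 * listSum (dtIntInt 0) (orbitCode.map (decode 16)) := by
  have h := isGauge_dtIntInt 0
  have e0 : (![0, 0, 0] : Vec) = 0 := by simp
  have e1 : IVec.toVec (1, 0, 0) = ![1, 0, 0] := by simp [IVec.toVec]
  have e2 : IVec.toVec (0, 1, 0) = ![0, 1, 0] := by simp [IVec.toVec]
  have e3 : IVec.toVec (0, 0, 1) = ![0, 0, 1] := by simp [IVec.toVec]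
  have b := h.simplexInt_le 6 (1, 0, 0) (0, 1, 0) (0, 0, 1)
  have hs : listSum (dtIntInt 0) upPoints = listSum (dtIntInt 0) (upPoints.map IVec.sort) := by
    simp [listSum, Function.comp_def, IVec.dtIntInt_sort]
  rw [listSum_perm _ upPoints_sort_perm, h.listSum_expand, upOrbits_eq,
    show (128 : ℤ) = ((128 : ℕ) : ℤ) from rfl, h.listSum_scale] at hs
  have : bisect vertices 6 (1, 0, 0) (0, 1, 0) (0, 0, 1) = upPoints := rfl
  rw [this, hs, e1, e2, e3] at b
  rw [pyr_integral_of_even h.continuous dtIntInt_flip0 dtIntInt_flip1,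
    corner_integral_eq_simplexInt, e0]
  push_cast at b
  linarith

theorem pyrInt_zero_le : pyrInt 0 ≤ 372 / 100 * cornerVol ^ 3 := by
  have hκ := cornerVol_pos
  set c := cornerVol / 512 with hc
  have hc0 : 0 ≤ c := by positivity
  have hneg₃ (u v w : Vec) : |dt u v (-w)| = |dt u v w| := by
    rw [show dt u v (-w) = -dt u v w by simp [dt]; ring, abs_neg]
  have hneg₂ (u v w : Vec) : |dt u (-v) w| = |dt u v w| := by
    rw [show dt u (-v) w = -dt u v w by simp [dt]; ring, abs_neg]
  have h1 (u : Vec) : dtIntInt 0 u ≤ c * (c * listSum (fun v => listSum (fun w => |dt u v w|)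
      (upCode.map (decode 16))) (upCode.map (decode 16))) := by
    have h2 (v : Vec) : dtInt 0 u v ≤
        c * listSum (fun w => |dt u v w|) (upCode.map (decode 16)) := by
      simpa only [dtInt, sub_zero] using
        (isGauge_abs_dt₃ u v).pyr_integral_le fun w => hneg₃ _ _ _
    have h3 := (isGauge_dtInt₂ 0 u).pyr_integral_le fun v => by simp only [dtInt, hneg₂]
    rw [← listSum_const_mul]
    simp only [dtIntInt, sub_zero]
    exact h3.trans (mul_le_mul_of_nonneg_left (listSum_le h2 _) hc0)
  have h2 := pyr_integral_dtIntInt_le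
  have h3 := listSum_le h1 (orbitCode.map (decode 16))
  have h4 : ∀ l : List NVec, listSum (fun u => listSum (fun v => listSum (fun w => |dt u v w|)
      (upCode.map (decode 16))) (upCode.map (decode 16))) (l.map (decode 16)) =
      2 * ((l.map fun r => pairSum 16 r upCode).sum : ℕ) := fun l => by
    induction l with
    | nil => simp
    | cons r l ih =>
      rw [List.map_cons, listSum_cons, ih, ← cast_pairSum]
      simp only [List.map_cons, List.sum_cons]
      push_cast; ring
  simp only [listSum_const_mul, h4] at h3
  have h5 : (((orbitCode.map fun r => pairSum 16 r upCode).sum : ℕ) : ℝ) ≤ 15600000 := by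
    exact_mod_cast sum_pairSum_le
  rw [pyrInt_eq]
  simp only [sub_zero]
  refine h2.trans ((mul_le_mul_of_nonneg_left h3 (by positivity)).trans ?_)
  rw [hc]
  have : 0 < cornerVol ^ 3 := by positivity
  nlinarith

theorem non_monotonicity_dim3 :
    ∃ L K : Set (Fin 3 → ℝ),
      Convex ℝ L ∧ IsCompact L ∧ (interior L).Nonempty ∧
      Convex ℝ K ∧ IsCompact K ∧ (interior K).Nonempty ∧ L ⊆ K ∧
      (∫ y₁ in L, ∫ y₂ in L, ∫ y₃ in L, ∫ y₄ in L,
          (volume (convexHull ℝ ({y₁, y₂, y₃, y₄} : Set (Fin 3 → ℝ)))).toReal) /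
          (volume L).toReal ^ 4
        > (∫ x₁ in K, ∫ x₂ in K, ∫ x₃ in K, ∫ x₄ in K,
            (volume (convexHull ℝ ({x₁, x₂, x₃, x₄} : Set (Fin 3 → ℝ)))).toReal) /
            (volume K).toReal ^ 4 :=
  main_of_bounds pyrInt_zero_le le_pyrInt
end

section
/- Let T be a tetrahedron of volume 1, c the centroid of a facet, X_1,...,X_4 iid uniform in T. If E[vol(conv{X_1,X_2,X_3,c})] < E[vol(conv{X_1,...,X_4})], then there exists a convex body L contained in a convex body K in R^3 such that the expected volume of the convex hull of 4 iid uniform points is strictly larger for L than for K. -/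
open MeasureTheory
open scoped Pointwise

/-- The volume of a simplex is a fixed multiple of the absolute determinant of its edge matrix. -/
theorem volume_convexHull_tetrahedron (a b c d : Fin 3 → ℝ) :
    (volume (convexHull ℝ ({a, b, c, d} : Set (Fin 3 → ℝ)))).toReal =
      |(Matrix.of ![b - a, c - a, d - a]).det| *
        (volume (convexHull ℝ
          (insert 0 (Set.range fun i : Fin 3 ↦ (Pi.single i 1 : Fin 3 → ℝ))))).toReal := by
  set M : Matrix (Fin 3) (Fin 3) ℝ := Matrix.of ![b - a, c - a, d - a] with hM
  have himage : ({a, b, c, d} : Set (Fin 3 → ℝ)) =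
      a +ᵥ (Matrix.toLin' M.transpose) ''
        insert 0 (Set.range fun i : Fin 3 ↦ (Pi.single i 1 : Fin 3 → ℝ)) := by
    rw [Set.image_insert_eq, ← Set.range_comp]
    have hrange : Set.range ((Matrix.toLin' M.transpose) ∘
        fun i : Fin 3 ↦ (Pi.single i 1 : Fin 3 → ℝ)) = {b - a, c - a, d - a} := by
      ext x
      simp only [Set.mem_range, Fin.exists_fin_succ, Function.comp, Matrix.toLin'_apply,
        Matrix.mulVec_single_one, Set.mem_insert_iff, Set.mem_singleton_iff]
      simp [hM, Matrix.col, eq_comm, funext_iff]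
    rw [hrange, map_zero]
    simp [Set.image_insert_eq, ← Set.image_vadd]
  rw [himage, convexHull_vadd, measure_vadd, ← LinearMap.image_convexHull,
    Measure.addHaar_image_linearMap, LinearMap.det_toLin', Matrix.det_transpose,
    ENNReal.toReal_mul, ENNReal.toReal_ofReal (abs_nonneg _)]

theorem continuous_volume_convexHull_tetrahedron :
    Continuous fun p : (Fin 3 → ℝ) × (Fin 3 → ℝ) × (Fin 3 → ℝ) × (Fin 3 → ℝ) ↦
      (volume (convexHull ℝ ({p.1, p.2.1, p.2.2.1, p.2.2.2} : Set (Fin 3 → ℝ)))).toReal := by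
  simp only [volume_convexHull_tetrahedron, Matrix.det_fin_three]
  simp only [Matrix.of_apply, Matrix.cons_val_zero, Matrix.cons_val_one, Matrix.cons_val,
    Pi.sub_apply]
  fun_prop

section IteratedIntegral

variable {E : Type*} [NormedAddCommGroup E] [MeasurableSpace E] [BorelSpace E] {μ : Measure E}
  [IsLocallyFiniteMeasure μ] {T : Set E}

theorem continuous_setIntegral_of_subset_isCompact {X : Type*} [TopologicalSpace X]
    [FirstCountableTopology X] [LocallyCompactSpace X] {f : X → E → ℝ}
    (hf : Continuous f.uncurry) (hT : IsCompact T) {A : Set E} (hA : A ⊆ T) :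
    Continuous fun x ↦ ∫ y in A, f x y ∂μ := by
  have h := continuous_parametric_integral_of_continuous (μ := μ.restrict A) hf hT
  rwa [Measure.restrict_restrict hT.measurableSet, Set.inter_eq_right.2 hA] at h

variable [ProperSpace E]

theorem setIntegral_setIntegral_swap {f : E → E → ℝ} (hf : Continuous f.uncurry)
    (hT : IsCompact T) {A B : Set E} (hA : A ⊆ T) (hB : B ⊆ T) :
    ∫ x in A, ∫ y in B, f x y ∂μ ∂μ = ∫ y in B, ∫ x in A, f x y ∂μ ∂μ := by
  refine integral_integral_swap ?_
  rw [Measure.prod_restrict]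
  exact (hf.continuousOn.integrableOn_compact (hT.prod hT)).mono_set (Set.prod_mono hA hB)

/-- The integral of a function of four variables over a product of four sets. -/
noncomputable def iteratedIntegral (μ : Measure E) (V : E → E → E → E → ℝ) (A B C D : Set E) : ℝ :=
  ∫ x in A, ∫ y in B, ∫ z in C, ∫ w in D, V x y z w ∂μ ∂μ ∂μ ∂μ

variable {V : E → E → E → E → ℝ} {A B C D : Set E}

theorem continuous_integral_last
    (hV : Continuous fun p : E × E × E × E ↦ V p.1 p.2.1 p.2.2.1 p.2.2.2) (hT : IsCompact T)
    (hD : D ⊆ T) :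
    Continuous fun p : E × E × E ↦ ∫ w in D, V p.1 p.2.1 p.2.2 w ∂μ :=
  continuous_setIntegral_of_subset_isCompact
    (f := fun (p : E × E × E) w ↦ V p.1 p.2.1 p.2.2 w)
    (hV.comp (f := fun q : (E × E × E) × E ↦ (q.1.1, q.1.2.1, q.1.2.2, q.2)) (by fun_prop)) hT hD

theorem continuous_integral_last_two
    (hV : Continuous fun p : E × E × E × E ↦ V p.1 p.2.1 p.2.2.1 p.2.2.2) (hT : IsCompact T)
    (hC : C ⊆ T) (hD : D ⊆ T) :
    Continuous fun p : E × E ↦ ∫ z in C, ∫ w in D, V p.1 p.2 z w ∂μ ∂μ :=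
  continuous_setIntegral_of_subset_isCompact
    (f := fun (p : E × E) z ↦ ∫ w in D, V p.1 p.2 z w ∂μ)
    ((continuous_integral_last hV hT hD).comp
      (f := fun q : (E × E) × E ↦ (q.1.1, q.1.2, q.2)) (by fun_prop)) hT hC

theorem continuous_integral_last_three
    (hV : Continuous fun p : E × E × E × E ↦ V p.1 p.2.1 p.2.2.1 p.2.2.2) (hT : IsCompact T)
    (hB : B ⊆ T) (hC : C ⊆ T) (hD : D ⊆ T) :
    Continuous fun x : E ↦ ∫ y in B, ∫ z in C, ∫ w in D, V x y z w ∂μ ∂μ ∂μ :=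
  continuous_setIntegral_of_subset_isCompact
    (f := fun x y ↦ ∫ z in C, ∫ w in D, V x y z w ∂μ ∂μ)
    (continuous_integral_last_two hV hT hC hD) hT hB

/-- The iterated integral of a symmetric function is invariant under cycling the four sets. -/
theorem iteratedIntegral_rotate
    (hV : Continuous fun p : E × E × E × E ↦ V p.1 p.2.1 p.2.2.1 p.2.2.2) (hT : IsCompact T)
    (h₁₂ : ∀ x y z w, V x y z w = V y x z w)
    (h₂₃ : ∀ x y z w, V x y z w = V x z y w) (h₃₄ : ∀ x y z w, V x y z w = V x y w z)
    (hA : A ⊆ T) (hB : B ⊆ T) (hC : C ⊆ T) (hD : D ⊆ T) :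
    iteratedIntegral μ V A B C D = iteratedIntegral μ V B C D A := by
  unfold iteratedIntegral
  rw [setIntegral_setIntegral_swap (continuous_integral_last_two hV hT hC hD) hT hA hB]
  congr 1 with y
  rw [setIntegral_setIntegral_swap (f := fun x z ↦ ∫ w in D, V x y z w ∂μ)
    ((continuous_integral_last hV hT hD).comp (f := fun q : E × E ↦ (q.1, y, q.2))
      (by fun_prop)) hT hA hC]
  congr 1 with z
  rw [setIntegral_setIntegral_swap (f := fun x w ↦ V x y z w)
    (hV.comp (f := fun q : E × E ↦ (q.1, y, z, q.2)) (by fun_prop)) hT hA hD]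
  simp_rw [h₁₂ _ y z, h₂₃ y _ z, h₃₄ y z]

theorem iteratedIntegral_add_diff
    (hV : Continuous fun p : E × E × E × E ↦ V p.1 p.2.1 p.2.2.1 p.2.2.2) (hT : IsCompact T)
    (hA : A ⊆ T) (hB : B ⊆ T) (hC : C ⊆ T) (hD : D ⊆ T) {L : Set E}
    (hL : MeasurableSet L) (hLA : L ⊆ A) :
    iteratedIntegral μ V A B C D =
      iteratedIntegral μ V L B C D + iteratedIntegral μ V (A \ L) B C D := by
  have hint := ((continuous_integral_last_three (μ := μ) hV hT hB hC
    hD).continuousOn.integrableOn_compact hT).mono_set (μ := μ) hA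
  have h := integral_inter_add_sdiff hL hint
  rw [Set.inter_eq_right.2 hLA] at h
  exact h.symm

theorem iteratedIntegral_mono
    (hV : Continuous fun p : E × E × E × E ↦ V p.1 p.2.1 p.2.2.1 p.2.2.2) (hT : IsCompact T)
    (hV₀ : ∀ x y z w, 0 ≤ V x y z w)
    (hA : A ⊆ T) (hB : B ⊆ T) (hC : C ⊆ T) (hD : D ⊆ T) {L : Set E} (hLA : L ⊆ A) :
    iteratedIntegral μ V L B C D ≤ iteratedIntegral μ V A B C D :=
  setIntegral_mono_set
    (((continuous_integral_last_three (μ := μ) hV hT hB hC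
      hD).continuousOn.integrableOn_compact hT).mono_set hA)
    (ae_of_all _ fun _ ↦ integral_nonneg fun _ ↦ integral_nonneg fun _ ↦ integral_nonneg fun _ ↦
      hV₀ _ _ _ _) hLA.eventuallyLE

/-- Shrinking `K` to `L` changes the fourfold integral by at most four times the integral with
one variable confined to `K \ L`. -/
theorem iteratedIntegral_sub_le
    (hV : Continuous fun p : E × E × E × E ↦ V p.1 p.2.1 p.2.2.1 p.2.2.2) (hT : IsCompact T)
    (hV₀ : ∀ x y z w, 0 ≤ V x y z w)
    (h₁₂ : ∀ x y z w, V x y z w = V y x z w)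
    (h₂₃ : ∀ x y z w, V x y z w = V x z y w) (h₃₄ : ∀ x y z w, V x y z w = V x y w z)
    {L K : Set E} (hL : MeasurableSet L) (hLK : L ⊆ K) (hK : K ⊆ T) :
    iteratedIntegral μ V K K K K - iteratedIntegral μ V L L L L ≤
      4 * iteratedIntegral μ V (K \ L) K K K := by
  have hLT := hLK.trans hK
  have hST : K \ L ⊆ T := Set.sdiff_subset.trans hK
  have rot {A B C D : Set E} (hA : A ⊆ T) (hB : B ⊆ T) (hC : C ⊆ T) (hD : D ⊆ T) :=
    iteratedIntegral_rotate (μ := μ) hV hT h₁₂ h₂₃ h₃₄ hA hB hC hD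
  have split {B C D : Set E} (hB : B ⊆ T) (hC : C ⊆ T) (hD : D ⊆ T) :=
    iteratedIntegral_add_diff (μ := μ) hV hT hK hB hC hD hL hLK
  have mono {B C D : Set E} (hB : B ⊆ T) (hC : C ⊆ T) (hD : D ⊆ T) :=
    iteratedIntegral_mono (μ := μ) hV hT hV₀ hK hB hC hD hLK
  linarith [split hK hK hK, rot hLT hK hK hK, split hK hK hLT, rot hLT hK hK hLT,
    split hK hLT hLT, rot hLT hK hLT hLT, split hLT hLT hLT,
    rot hST hK hK hLT, rot hK hK hLT hST, rot hK hLT hST hK, mono hST hK hK,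
    rot hK hST hK hK, rot hST hK hLT hLT, rot hK hLT hLT hST, mono hLT hST hK,
    rot hST hLT hLT hLT, mono hLT hLT hST]

end IteratedIntegral

theorem div_pow_four_lt_div_pow_four {F F' g k s : ℝ} (hg : 0 ≤ g) (hgF : g < F) (hk : k ≤ 1)
    (hs : 0 < s) (hsk : s < k) (hsmall : 2 * s * F < k * (F - g)) (hF' : F - F' ≤ 4 * (s * g)) :
    F / k ^ 4 < F' / (k - s) ^ 4 := by
  have hk₀ : 0 < k := hs.trans hsk
  have hF : 0 < F := hg.trans_lt hgF
  rw [div_lt_div_iff₀ (by positivity) (pow_pos (sub_pos.2 hsk) 4)]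
  have hpow : (k - s) ^ 4 ≤ k ^ 4 - 4 * k ^ 3 * s + 6 * k ^ 2 * s ^ 2 := by
    have : s ^ 3 * s ≤ s ^ 3 * k := by gcongr
    nlinarith [pow_pos hs 3, mul_pos (pow_pos hs 3) hk₀]
  have hfirst : F * (k - s) ^ 4 ≤ F * (k ^ 4 - 4 * k ^ 3 * s + 6 * k ^ 2 * s ^ 2) := by gcongr
  have hsecond : (F - 4 * (s * g)) * k ^ 4 ≤ F' * k ^ 4 := by
    gcongr
    linarith
  have hgk : g * k ^ 2 ≤ g * k := by
    have : k ^ 2 ≤ k := by nlinarith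
    gcongr
  have hkey : 0 < 4 * F * k - 6 * F * s - 4 * g * k ^ 2 := by
    nlinarith [mul_pos hk₀ (sub_pos.2 hgF)]
  have hmul := mul_pos (mul_pos (pow_pos hk₀ 2) hs) hkey
  nlinarith

/-- The part of `T` above a cone with apex `c` and slope `ε`, heights being measured by `l`. -/
def abovePointedCone {E : Type*} [NormedAddCommGroup E] (T : Set E) (l : E → ℝ) (c : E) (ε : ℝ) :
    Set E :=
  {x ∈ T | ε * ‖x - c‖ ≤ l x}

section Cone

variable {E : Type*} [NormedAddCommGroup E] {T : Set E} {c : E} {ε δ : ℝ}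

theorem isClosed_abovePointedCone {l : E → ℝ} (hT : IsClosed T) (hl : Continuous l) :
    IsClosed (abovePointedCone T l c ε) :=
  hT.inter (isClosed_le (by fun_prop) hl)

variable [NormedSpace ℝ E]

theorem convex_abovePointedCone {l : E →ᵃ[ℝ] ℝ} (hT : Convex ℝ T) (hε : 0 ≤ ε) :
    Convex ℝ (abovePointedCone T l c ε) := by
  intro x hx y hy s t hs ht hst
  refine ⟨hT hx.1 hy.1 hs ht hst, ?_⟩
  rw [Convex.combo_affine_apply hst]
  have hxy : s • x + t • y - c = s • (x - c) + t • (y - c) := by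
    rw [smul_sub, smul_sub, sub_add_sub_comm, ← add_smul, hst, one_smul]
  calc ε * ‖s • x + t • y - c‖ ≤ ε * (s * ‖x - c‖ + t * ‖y - c‖) := by
        rw [hxy]
        gcongr
        refine (norm_add_le _ _).trans_eq ?_
        rw [norm_smul_of_nonneg hs, norm_smul_of_nonneg ht]
    _ = s * (ε * ‖x - c‖) + t * (ε * ‖y - c‖) := by ring
    _ ≤ s • l x + t • l y := by
        simp only [smul_eq_mul]
        gcongr
        exacts [hx.2, hy.2]

/-- Near its apex the cone has interior points of arbitrarily small height. -/
theorem exists_mem_interior_lt {l : E →ᵃ[ℝ] ℝ} (hT : Convex ℝ T) (hc : c ∈ T) (hlc : l c = 0)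
    {m : E} (hm : m ∈ interior T) (hlm : ε * ‖m - c‖ < l m) (hε : 0 ≤ ε) (hδ : 0 < δ) :
    ∃ x ∈ interior T, ε * ‖x - c‖ < l x ∧ l x < δ := by
  have hlm₀ : 0 < l m := lt_of_le_of_lt (by positivity) hlm
  obtain ⟨t, ht₀, ht⟩ : ∃ t : ℝ, 0 < t ∧ t < min 1 (δ / l m) := exists_between (by positivity)
  have ht₁ : t < 1 := ht.trans_le (min_le_left _ _)
  have htδ : t * l m < δ := (lt_div_iff₀ hlm₀).1 (ht.trans_le (min_le_right _ _))
  have hval : l (AffineMap.lineMap c m t) = t * l m := by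
    rw [AffineMap.apply_lineMap, hlc, AffineMap.lineMap_apply]
    simp
  refine ⟨AffineMap.lineMap c m t, ?_, ?_, hval ▸ htδ⟩
  · rw [AffineMap.lineMap_apply, vsub_eq_sub, vadd_eq_add, add_comm]
    exact hT.add_smul_sub_mem_interior hc hm ⟨ht₀, ht₁.le⟩
  · rw [hval, AffineMap.lineMap_apply, vsub_eq_sub, vadd_eq_add, add_sub_cancel_right,
      norm_smul_of_nonneg ht₀.le]
    nlinarith

end Cone

/-- The complement of a flat enough cone in `T` has small measure. -/
theorem tendsto_measure_diff_abovePointedCone {E : Type*} [NormedAddCommGroup E] [NormedSpace ℝ E]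
    [FiniteDimensional ℝ E] [MeasurableSpace E] [BorelSpace E] (μ : Measure E) [μ.IsAddHaarMeasure]
    {T : Set E} (hT : Convex ℝ T) (hcomp : IsCompact T) {l : E → ℝ} (hl : Continuous l)
    (hpos : ∀ x ∈ interior T, 0 < l x) (c : E) :
    Filter.Tendsto (fun n : ℕ ↦ μ (T \ abovePointedCone T l c (1 / ((n : ℝ) + 1))))
      Filter.atTop (nhds 0) := by
  have hzero : μ (⋂ n : ℕ, T \ abovePointedCone T l c (1 / ((n : ℝ) + 1))) = 0 := by
    refine measure_mono_null (fun x hx ↦ ?_) (hT.addHaar_frontier μ)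
    rw [Set.mem_iInter] at hx
    refine ⟨subset_closure (hx 0).1, fun hxi ↦ ?_⟩
    have hlim : Filter.Tendsto (fun n : ℕ ↦ 1 / ((n : ℝ) + 1) * ‖x - c‖) Filter.atTop
        (nhds 0) := by
      simpa using tendsto_one_div_add_atTop_nhds_zero_nat.mul_const ‖x - c‖
    obtain ⟨n, hn⟩ := (hlim.eventually (gt_mem_nhds (hpos x hxi))).exists
    exact (hx n).2 ⟨(hx n).1, hn.le⟩
  rw [← hzero]
  refine tendsto_measure_iInter_atTop (fun n ↦ ?_) (fun i j hij ↦ ?_) ⟨0, ?_⟩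
  · exact (hcomp.measurableSet.diff
      (isClosed_abovePointedCone hcomp.isClosed hl).measurableSet).nullMeasurableSet
  · refine Set.sdiff_subset_sdiff_right fun x hx ↦ ⟨hx.1, le_trans ?_ hx.2⟩
    gcongr
  · exact ((measure_mono Set.sdiff_subset).trans_lt hcomp.measure_lt_top).ne

theorem tendsto_measureReal_closedBall_nhds_zero (c : Fin 3 → ℝ) :
    Filter.Tendsto (fun r : ℝ ↦ volume.real (Metric.closedBall c r)) (nhdsWithin 0 (Set.Ioi 0))
      (nhds 0) := by
  have hlim : Filter.Tendsto (fun r : ℝ ↦ (2 * r) ^ 3) (nhdsWithin 0 (Set.Ioi 0)) (nhds 0) := by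
    have : Continuous fun r : ℝ ↦ (2 * r) ^ 3 := by fun_prop
    simpa using (this.tendsto 0).mono_left nhdsWithin_le_nhds
  refine hlim.congr' ?_
  filter_upwards [self_mem_nhdsWithin] with r hr
  have hr₀ : 0 < r := hr
  rw [measureReal_def, Real.volume_pi_closedBall c hr₀.le, ENNReal.toReal_ofReal (by positivity),
    Fintype.card_fin]

/-- If fixing one argument of `V` at a boundary point `c` of `T` lowers its mean, then some convex
body inside `T` has a convex subbody on which the mean of `V` is larger. -/
theorem exists_convexBody_mean_lt {V : (Fin 3 → ℝ) → (Fin 3 → ℝ) → (Fin 3 → ℝ) → (Fin 3 → ℝ) → ℝ}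
    (hV : Continuous fun p : (Fin 3 → ℝ) × (Fin 3 → ℝ) × (Fin 3 → ℝ) × (Fin 3 → ℝ) ↦
      V p.1 p.2.1 p.2.2.1 p.2.2.2)
    (hV₀ : ∀ x y z w, 0 ≤ V x y z w) (h₁₂ : ∀ x y z w, V x y z w = V y x z w)
    (h₂₃ : ∀ x y z w, V x y z w = V x z y w) (h₃₄ : ∀ x y z w, V x y z w = V x y w z)
    {T : Set (Fin 3 → ℝ)} (hT : Convex ℝ T) (hcomp : IsCompact T) (hvol : volume T = 1)
    {l : (Fin 3 → ℝ) →ᵃ[ℝ] ℝ} (hl : Continuous l) (hpos : ∀ x ∈ interior T, 0 < l x)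
    {c : Fin 3 → ℝ} (hc : c ∈ T) (hlc : l c = 0)
    (hlt : ∫ y in T, ∫ z in T, ∫ w in T, V c y z w < iteratedIntegral volume V T T T T) :
    ∃ L K : Set (Fin 3 → ℝ),
      Convex ℝ L ∧ IsCompact L ∧ (interior L).Nonempty ∧
      Convex ℝ K ∧ IsCompact K ∧ (interior K).Nonempty ∧ L ⊆ K ∧
      iteratedIntegral volume V K K K K / volume.real K ^ 4 <
        iteratedIntegral volume V L L L L / volume.real L ^ 4 := by
  set G : (Fin 3 → ℝ) → ℝ := fun x ↦ ∫ y in T, ∫ z in T, ∫ w in T, V x y z w with hG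
  have hGcont : Continuous G :=
    continuous_integral_last_three hV hcomp subset_rfl subset_rfl subset_rfl
  have hG₀ (x) : 0 ≤ G x := integral_nonneg fun _ ↦ integral_nonneg fun _ ↦ integral_nonneg fun _ ↦
    hV₀ _ _ _ _
  have loss {L K : Set (Fin 3 → ℝ)} (hL : MeasurableSet L) (hLK : L ⊆ K) (hK : K ⊆ T)
      (hKm : MeasurableSet K) {g : ℝ} (hg : ∀ x ∈ K \ L, G x ≤ g) :
      iteratedIntegral volume V K K K K - iteratedIntegral volume V L L L L ≤
        4 * (volume.real (K \ L) * g) := by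
    refine (iteratedIntegral_sub_le hV hcomp hV₀ h₁₂ h₂₃ h₃₄ hL hLK hK).trans ?_
    have hST : K \ L ⊆ T := Set.sdiff_subset.trans hK
    have rot {A B C D : Set (Fin 3 → ℝ)} (hA : A ⊆ T) (hB : B ⊆ T) (hC : C ⊆ T) (hD : D ⊆ T) :=
      iteratedIntegral_rotate (μ := volume) hV hcomp h₁₂ h₂₃ h₃₄ hA hB hC hD
    have mono {B C D : Set (Fin 3 → ℝ)} (hB : B ⊆ T) (hC : C ⊆ T) (hD : D ⊆ T) :=
      iteratedIntegral_mono (μ := volume) hV hcomp hV₀ subset_rfl hB hC hD hK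
    have hKT : iteratedIntegral volume V (K \ L) K K K ≤
        iteratedIntegral volume V (K \ L) T T T := by
      have hTT := subset_refl T
      linarith [rot hST hK hK hK, mono hK hK hST, rot hTT hK hK hST, mono hK hST hTT,
        rot hTT hK hST hTT, mono hST hTT hTT, rot hTT hST hTT hTT]
    have hfin : volume (K \ L) ≠ ⊤ := ((measure_mono hST).trans_lt hcomp.measure_lt_top).ne
    have hle : iteratedIntegral volume V (K \ L) T T T ≤ ∫ _ in K \ L, g :=
      setIntegral_mono_on ((hGcont.continuousOn.integrableOn_compact hcomp).mono_set hST)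
        (integrableOn_const hfin) (hKm.diff hL) hg
    rw [setIntegral_const, smul_eq_mul] at hle
    linarith
  set F := iteratedIntegral volume V T T T T with hF
  obtain ⟨g, hcg, hgF⟩ := exists_between hlt
  have hg₀ : 0 ≤ g := (hG₀ c).trans hcg.le
  obtain ⟨r, hr, hball⟩ := Metric.nhds_basis_closedBall.eventually_iff.1
    (hGcont.continuousAt.eventually (gt_mem_nhds hcg))
  obtain ⟨M, hM⟩ := hcomp.exists_bound_of_continuousOn hGcont.continuousOn
  obtain ⟨m, hm⟩ : (interior T).Nonempty := by
    rw [Set.nonempty_iff_ne_empty]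
    intro hempty
    have h₀ := hT.addHaar_frontier volume
    rw [frontier, hempty, Set.sdiff_empty, hcomp.isClosed.closure_eq, hvol] at h₀
    exact one_ne_zero h₀
  -- the intermediate body `K`
  obtain ⟨ε, hε, hKF, hmK⟩ : ∃ ε : ℝ, 0 < ε ∧
      4 * (volume.real (T \ abovePointedCone T l c ε) * M) < F - g ∧ ε * ‖m - c‖ < l m := by
    have hlim := (ENNReal.tendsto_toReal ENNReal.zero_ne_top).comp
      (tendsto_measure_diff_abovePointedCone volume hT hcomp hl hpos c)
    have hlim₁ := (hlim.mul_const M).const_mul 4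
    have hlim₂ := (tendsto_one_div_add_atTop_nhds_zero_nat (𝕜 := ℝ)).mul_const ‖m - c‖
    simp only [ENNReal.toReal_zero, zero_mul, mul_zero] at hlim₁ hlim₂
    obtain ⟨n, hn₁, hn₂⟩ := ((hlim₁.eventually (gt_mem_nhds (sub_pos.2 hgF))).and
      (hlim₂.eventually (gt_mem_nhds (hpos m hm)))).exists
    exact ⟨1 / ((n : ℝ) + 1), by positivity, hn₁, hn₂⟩
  set K := abovePointedCone T l c ε with hK
  have hKT : K ⊆ T := fun x hx ↦ hx.1
  have hKclosed : IsClosed K := isClosed_abovePointedCone hcomp.isClosed hl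
  have hKcomp : IsCompact K := hcomp.of_isClosed_subset hKclosed hKT
  have hKconv : Convex ℝ K := convex_abovePointedCone hT hε.le
  have hopen (δ : ℝ) : IsOpen {x | x ∈ interior T ∧ ε * ‖x - c‖ < l x ∧ δ < l x} :=
    isOpen_interior.inter ((isOpen_lt (by fun_prop) hl).inter (isOpen_lt continuous_const hl))
  have hgFK : g < iteratedIntegral volume V K K K K := by
    have := loss hKclosed.measurableSet hKT subset_rfl hcomp.measurableSet
      (fun x hx ↦ (le_abs_self _).trans (hM x hx.1))
    linarith
  set FK := iteratedIntegral volume V K K K K with hFK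
  have hFK₀ : 0 < FK := hg₀.trans_lt hgFK
  have hlm : 0 < l m := hpos m hm
  have hmint : ∀ δ < l m, m ∈ interior {x ∈ K | δ ≤ l x} := fun δ hδ ↦
    mem_interior.2 ⟨_, fun _ hx ↦ ⟨⟨interior_subset hx.1, hx.2.1.le⟩, hx.2.2.le⟩, hopen δ,
      hm, hmK, hδ⟩
  have hKint : (interior K).Nonempty :=
    ⟨m, interior_mono (fun x hx ↦ hx.1) (hmint 0 hlm)⟩
  have hKfin : volume K ≠ ⊤ := hKcomp.measure_lt_top.ne
  have hk₀ : 0 < volume.real K :=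
    ENNReal.toReal_pos (Measure.measure_pos_of_nonempty_interior _ hKint).ne' hKfin
  have hk₁ : volume.real K ≤ 1 := by
    have : volume.real T = 1 := by simp [measureReal_def, hvol]
    exact this ▸ measureReal_mono hKT hcomp.measure_lt_top.ne
  -- the truncation height `δ`
  have htarget : 0 < min (volume.real K) (volume.real K * (FK - g) / (2 * FK)) :=
    lt_min hk₀ (div_pos (mul_pos hk₀ (sub_pos.2 hgFK)) (by positivity))
  obtain ⟨ρ, hρball, hρ₀, hρ⟩ := (((tendsto_measureReal_closedBall_nhds_zero c).eventually
    (gt_mem_nhds htarget)).and (Ioo_mem_nhdsGT (lt_min hr (div_pos hlm hε)))).exists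
  have hδ₀ : 0 < ρ * ε := mul_pos hρ₀ hε
  have hδm : ρ * ε < l m := (lt_div_iff₀ hε).1 (hρ.trans_le (min_le_right _ _))
  set L := {x ∈ K | ρ * ε ≤ l x} with hL
  have hLK : L ⊆ K := fun x hx ↦ hx.1
  have hLclosed : IsClosed L := hKclosed.inter (isClosed_le continuous_const hl)
  have hcap : K \ L ⊆ Metric.closedBall c ρ := by
    intro x hx
    have hlx : l x < ρ * ε := not_le.1 fun h ↦ hx.2 ⟨hx.1, h⟩
    have hxc := hx.1.2
    rw [mem_closedBall_iff_norm]
    nlinarith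
  have hs : volume.real (K \ L) < min (volume.real K) (volume.real K * (FK - g) / (2 * FK)) :=
    (measureReal_mono hcap (isCompact_closedBall c ρ).measure_lt_top.ne).trans_lt hρball
  have hs₀ : 0 < volume.real (K \ L) := by
    obtain ⟨x, hxT, hxε, hxδ⟩ := exists_mem_interior_lt hT hc hlc hm hmK hε.le hδ₀
    have hU : IsOpen {x | x ∈ interior T ∧ ε * ‖x - c‖ < l x ∧ l x < ρ * ε} :=
      isOpen_interior.inter ((isOpen_lt (by fun_prop) hl).inter (isOpen_lt hl continuous_const))
    have hxint : x ∈ interior (K \ L) := mem_interior.2 ⟨_,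
      fun _ hy ↦ ⟨⟨interior_subset hy.1, hy.2.1.le⟩, fun h ↦ hy.2.2.not_ge h.2⟩, hU,
      hxT, hxε, hxδ⟩
    exact ENNReal.toReal_pos (Measure.measure_pos_of_nonempty_interior _ ⟨x, hxint⟩).ne'
      ((measure_mono Set.sdiff_subset).trans_lt hKcomp.measure_lt_top).ne
  have hLvol : volume.real L = volume.real K - volume.real (K \ L) := by
    rw [measureReal_sdiff hLK hLclosed.measurableSet]
    ring
  refine ⟨L, K, ?_, hKcomp.of_isClosed_subset hLclosed hLK, ⟨m, hmint _ hδm⟩, hKconv, hKcomp,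
    hKint, hLK, ?_⟩
  · exact hKconv.inter ((convex_Ici (ρ * ε)).affine_preimage l)
  · rw [hLvol]
    refine div_pow_four_lt_div_pow_four hg₀ hgFK hk₁ hs₀ (hs.trans_le (min_le_left _ _)) ?_
      (loss hLclosed.measurableSet hLK hKT hKclosed.measurableSet fun x hx ↦ (hball ?_).le)
    · have := (lt_div_iff₀ (by positivity)).1 (hs.trans_le (min_le_right _ _))
      linarith
    · exact Metric.closedBall_subset_closedBall (hρ.le.trans (min_le_left _ _)) (hcap hx)

theorem rademacher_application (v : Fin 4 → (Fin 3 → ℝ))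
    (hv : AffineIndependent ℝ v) (T : Set (Fin 3 → ℝ))
    (hT : T = convexHull ℝ (Set.range v)) (hvol : volume T = 1)
    (c : Fin 3 → ℝ) (hc : c = (3:ℝ)⁻¹ • (v 0 + v 1 + v 2))
    (hlt : (∫ x₁ in T, ∫ x₂ in T, ∫ x₃ in T,
          (volume (convexHull ℝ ({x₁, x₂, x₃, c} : Set (Fin 3 → ℝ)))).toReal)
        < ∫ x₁ in T, ∫ x₂ in T, ∫ x₃ in T, ∫ x₄ in T,
            (volume (convexHull ℝ ({x₁, x₂, x₃, x₄} : Set (Fin 3 → ℝ)))).toReal) :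
    ∃ L K : Set (Fin 3 → ℝ),
      Convex ℝ L ∧ IsCompact L ∧ (interior L).Nonempty ∧
      Convex ℝ K ∧ IsCompact K ∧ (interior K).Nonempty ∧ L ⊆ K ∧
      (∫ y₁ in L, ∫ y₂ in L, ∫ y₃ in L, ∫ y₄ in L,
          (volume (convexHull ℝ ({y₁, y₂, y₃, y₄} : Set (Fin 3 → ℝ)))).toReal) /
          (volume L).toReal ^ 4
        > (∫ x₁ in K, ∫ x₂ in K, ∫ x₃ in K, ∫ x₄ in K,
            (volume (convexHull ℝ ({x₁, x₂, x₃, x₄} : Set (Fin 3 → ℝ)))).toReal) /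
            (volume K).toReal ^ 4 := by
  let b : AffineBasis (Fin 4) ℝ (Fin 3 → ℝ) :=
    ⟨v, hv, hv.affineSpan_eq_top_iff_card_eq_finrank_add_one.2 (by simp)⟩
  have hTb : T = convexHull ℝ (Set.range b) := hT
  have hconv : Convex ℝ T := hT ▸ convex_convexHull ℝ _
  have hcomp : IsCompact T := hT ▸ (Set.finite_range v).isCompact_convexHull ℝ
  have hfacet : Convex ℝ (T ∩ b.coord 3 ⁻¹' {0}) :=
    hconv.inter ((convex_singleton 0).affine_preimage _)
  have hvertex (i : Fin 4) (hi : i ≠ 3) : v i ∈ T ∩ b.coord 3 ⁻¹' {0} :=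
    ⟨hT ▸ subset_convexHull ℝ _ (Set.mem_range_self i), b.coord_apply_ne hi.symm⟩
  have hcfacet : c ∈ T ∩ b.coord 3 ⁻¹' {0} := by
    have h := hfacet.sum_mem (t := Finset.univ) (w := fun _ : Fin 3 ↦ (3 : ℝ)⁻¹)
      (z := ![v 0, v 1, v 2]) (fun _ _ ↦ by positivity) (by simp) (by
        intro i _
        fin_cases i
        exacts [hvertex 0 (by decide), hvertex 1 (by decide), hvertex 2 (by decide)])
    simpa [Fin.sum_univ_three, hc, smul_add] using h
  refine exists_convexBody_mean_lt
    (V := fun x y z w ↦ (volume (convexHull ℝ ({x, y, z, w} : Set (Fin 3 → ℝ)))).toReal)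
    continuous_volume_convexHull_tetrahedron (fun _ _ _ _ ↦ ENNReal.toReal_nonneg)
    (fun x y z w ↦ by rw [Set.insert_comm]) (fun x y z w ↦ by rw [Set.insert_comm y])
    (fun x y z w ↦ by rw [Set.pair_comm]) hconv hcomp hvol
    (continuous_barycentric_coord b 3) (fun x hx ↦ ?_) hcfacet.1 hcfacet.2 ?_
  · rw [hTb, b.interior_convexHull] at hx
    exact hx 3
  · have hrotate (x y z : Fin 3 → ℝ) :
        ({c, x, y, z} : Set (Fin 3 → ℝ)) = {x, y, z, c} := by
      rw [Set.insert_comm c, Set.insert_comm c, Set.pair_comm c]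
    simp only [hrotate]
    exact hlt
end
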